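/- arXiv:1908.05075 — 9 statements merged into one kernel-verified Lean document; each statement's English description precedes it below -/
import Mathlib

section
/- Let G be a finite simple graph with maximum degree Δ(G) ≥ (|V(G)|-1)/2, and let k be an integer with k ≥ ⌈(Δ(G)+1)/2⌉. Then V(G) can be partitioned into k subsets whose sizes pairwise differ by at most one, such that each subset induces a linear forest in G. -/
/-- A graph is a *linear forest* if it is acyclic (a forest) and every vertex has at most
two neighbors; equivalently, every connected component is a path. -/
def SimpleGraph.IsLinearForest {V : Type*} (G : SimpleGraph V) : Prop :=
  G.IsAcyclic ∧ ∀ v a b c : V, G.Adj v a → G.Adj v b → G.Adj v c → a = b ∨ a = c ∨ b = c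

open Finset

/-- If every weight is at most `2`, each value up to `∑ w + 1` is a subset sum, up to one unit. -/
lemma exists_subset_sum_eq_or_succ_eq {ι : Type*} (w : ι → ℕ) (hw : ∀ i, w i ≤ 2)
    (J : Finset ι) : ∀ x ≤ ∑ i ∈ J, w i + 1,
      ∃ A ⊆ J, ∑ i ∈ A, w i = x ∨ ∑ i ∈ A, w i + 1 = x := by
  classical
  induction J using Finset.induction_on with
  | empty =>
    intro x hx
    refine ⟨∅, subset_rfl, ?_⟩
    simp at hx ⊢
    omega
  | insert a J ha ih =>
    intro x hx
    rw [sum_insert ha] at hx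
    have h2 := hw a
    by_cases h : x ≤ ∑ i ∈ J, w i + 1
    · obtain ⟨A, hA, h'⟩ := ih x h
      exact ⟨A, hA.trans (subset_insert _ _), h'⟩
    · obtain ⟨A, hA, h'⟩ := ih (x - w a) (by omega)
      refine ⟨insert a A, insert_subset_insert _ hA, ?_⟩
      rw [sum_insert fun h => ha (hA h)]
      omega

lemma exists_sum_eq_of_le_two {ι : Type*} [Fintype ι] (w : ι → ℕ) (hw : ∀ i, w i ≤ 2)
    {i₀ : ι} (h₀ : w i₀ = 1) {x : ℕ} (hx : x ≤ ∑ i, w i) :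
    ∃ A : Finset ι, ∑ i ∈ A, w i = x := by
  classical
  have hs := add_sum_erase univ w (mem_univ i₀)
  obtain ⟨A, hA, h | h⟩ := exists_subset_sum_eq_or_succ_eq w hw (univ.erase i₀) x (by omega)
  · exact ⟨A, h⟩
  · refine ⟨insert i₀ A, ?_⟩
    rw [sum_insert fun h => by simpa using hA h]
    omega

/-- A path can be cut into disjoint subpaths of prescribed orders. -/
lemma exists_disjoint_subpaths {V ι : Type*} (H : SimpleGraph V) (t : ι → ℕ) (I : Finset ι) :
    ∀ P : List V, P.IsChain H.Adj → P.Nodup → ∑ i ∈ I, t i ≤ P.length →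
      ∃ T : ι → List V,
        (∀ i ∈ I, (T i).IsChain H.Adj ∧ (T i).Nodup ∧ (T i).length = t i ∧ T i ⊆ P) ∧
        ∀ i ∈ I, ∀ j ∈ I, i ≠ j → (T i).Disjoint (T j) := by
  classical
  induction I using Finset.induction_on with
  | empty => intro P _ _ _; exact ⟨fun _ => [], by simp, by simp⟩
  | insert a I ha ih =>
    intro P hc hn hl
    rw [sum_insert ha] at hl
    obtain ⟨T, hT, hd⟩ := ih (P.drop (t a)) (hc.drop _) (hn.sublist (List.drop_sublist _ _))
      (by rw [List.length_drop]; omega)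
    have hne : ∀ i ∈ I, i ≠ a := fun i hi h => ha (h ▸ hi)
    have hda : ∀ i ∈ I, (P.take (t a)).Disjoint (T i) := fun i hi x hx hx' =>
      List.disjoint_take_drop hn le_rfl hx ((hT i hi).2.2.2 hx')
    refine ⟨Function.update T a (P.take (t a)), ?_, ?_⟩
    · intro i hi
      rcases mem_insert.1 hi with rfl | hi
      · rw [Function.update_self]
        refine ⟨hc.take _, hn.sublist (List.take_sublist _ _), ?_, List.take_subset _ _⟩
        rw [List.length_take]; omega
      · rw [Function.update_of_ne (hne i hi)]
        obtain ⟨h1, h2, h3, h4⟩ := hT i hi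
        exact ⟨h1, h2, h3, fun x hx => List.drop_subset _ _ (h4 hx)⟩
    · intro i hi j hj hij
      rcases mem_insert.1 hi with rfl | hi' <;> rcases mem_insert.1 hj with rfl | hj'
      · exact absurd rfl hij
      · rw [Function.update_self, Function.update_of_ne (hne j hj')]
        exact hda j hj'
      · rw [Function.update_self, Function.update_of_ne (hne i hi')]
        exact (hda i hi').symm
      · rw [Function.update_of_ne (hne i hi'), Function.update_of_ne (hne j hj')]
        exact hd i hi' j hj' hij

/-- A disjoint family can be enlarged to a partition with prescribed part sizes. -/
lemma exists_partition_extending {V ι : Type*} [Fintype V] [Fintype ι] (q : ι → ℕ)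
    (hq : ∑ i, q i = Fintype.card V) (T : ι → Finset V)
    (hT : Pairwise fun i j => Disjoint (T i) (T j)) (hle : ∀ i, (T i).card ≤ q i) :
    ∃ P : ι → Finset V, (∀ i, T i ⊆ P i) ∧ (∀ i, (P i).card = q i) ∧
      ∀ v, ∃! i, v ∈ P i := by
  classical
  induction h : ∑ i, (q i - (T i).card) generalizing T with
  | zero =>
    have heq : ∀ i, (T i).card = q i := fun i => by
      have := sum_eq_zero_iff.1 h i (mem_univ i)
      have := hle i
      omega
    refine ⟨T, fun _ => subset_rfl, heq, fun v => ?_⟩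
    have hU : univ.biUnion T = univ := by
      rw [← card_eq_iff_eq_univ, card_biUnion fun i _ j _ hij => hT hij, ← hq]
      exact sum_congr rfl fun i _ => heq i
    obtain ⟨i, -, hi⟩ := mem_biUnion.1 (hU ▸ mem_univ v)
    refine ⟨i, hi, fun j hj => ?_⟩
    by_contra hji
    exact disjoint_left.1 (hT hji) hj hi
  | succ m ih =>
    obtain ⟨a, -, ha⟩ := exists_ne_zero_of_sum_ne_zero (h.trans_ne (Nat.succ_ne_zero m))
    have hlt : ∑ i, (T i).card < ∑ i, q i :=
      sum_lt_sum (fun i _ => hle i) ⟨a, mem_univ a, by omega⟩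
    obtain ⟨v, hv⟩ : ∃ v, v ∉ univ.biUnion T := by
      by_contra! hall
      have := card_biUnion_le (s := univ) (t := T)
      rw [eq_univ_iff_forall.2 hall, card_univ] at this
      omega
    have hv' : ∀ i, v ∉ T i := fun i hi => hv (mem_biUnion.2 ⟨i, mem_univ i, hi⟩)
    have hca : (insert v (T a)).card = (T a).card + 1 := card_insert_of_notMem (hv' a)
    obtain ⟨P, h1, h2, h3⟩ := ih (Function.update T a (insert v (T a))) (by
        intro i j hij
        by_cases hi : i = a
        · subst hi
          simpa [Function.update_of_ne hij.symm, hv'] using hT hij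
        · by_cases hj : j = a
          · subst hj
            simpa [Function.update_of_ne hij, hv'] using hT hij
          · simpa [Function.update_of_ne hi, Function.update_of_ne hj] using hT hij)
      (by
        intro i
        by_cases hi : i = a
        · subst hi
          rw [Function.update_self]; omega
        · simpa [Function.update_of_ne hi] using hle i)
      (by
        rw [← add_sum_erase _ _ (mem_univ a)] at h ⊢
        rw [Function.update_self, hca,
          sum_congr rfl (g := fun i => q i - (T i).card) fun i hi => by
            rw [Function.update_of_ne (ne_of_mem_erase hi)]]
        omega)
    refine ⟨P, fun i => ?_, h2, h3⟩
    refine Subset.trans ?_ (h1 i)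
    by_cases hi : i = a
    · subst hi
      rw [Function.update_self]
      exact subset_insert _ _
    · rw [Function.update_of_ne hi]

/-- Reversing the final segment of a path whose end vertices have crossing neighbors gives a
cyclic ordering of the same vertices. -/
lemma exists_cyclic_reordering {V : Type*} (H : SimpleGraph V) {l : List V}
    (hc : l.IsChain H.Adj) {i : ℕ} (hi : i + 1 < l.length) (h₀ : H.Adj l[0] l[i + 1])
    (h₁ : H.Adj l[l.length - 1] l[i]) :
    ∃ c : List V, c.Perm l ∧ c.IsChain H.Adj ∧
      ∀ x ∈ c.getLast?, ∀ y ∈ c.head?, H.Adj x y := by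
  refine ⟨l.take (i + 1) ++ (l.drop (i + 1)).reverse, ?_, ?_, ?_⟩
  · conv_rhs => rw [← List.take_append_drop (i + 1) l]
    exact (List.reverse_perm _).append_left _
  · refine List.isChain_append.2 ⟨hc.take _, ?_, ?_⟩
    · rw [List.isChain_reverse]
      exact (hc.drop _).imp fun a b h => h.symm
    · intro x hx y hy
      have hx' : x = l[i] := by
        simp [List.getLast?_take] at hx
        grind
      have hy' : y = l[l.length - 1] := by
        simp [List.getLast?_drop] at hy
        grind
      rw [hx', hy']
      exact h₁.symm
  · intro x hx y hy
    have hx' : x = l[i + 1] := by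
      simp [List.getLast?_append] at hx
      grind
    have hy' : y = l[0] := by
      obtain ⟨z, l, rfl⟩ := List.exists_cons_of_length_pos (by omega : 0 < l.length)
      simpa using hy.symm
    rw [hx', hy']
    exact h₀.symm

/-- In a set closed under adjacency with all degrees at least `d`, there is a path with at least
`2 * d` vertices, or one with more than `d` vertices whose vertex set is closed under adjacency. -/
lemma exists_long_or_closed_path {V : Type*} [Fintype V] (H : SimpleGraph V) [DecidableRel H.Adj]
    {d : ℕ} (hd : ∀ v, d ≤ H.degree v) (S : Set V) (hS : ∀ x ∈ S, ∀ y, H.Adj x y → y ∈ S)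
    (hne : S.Nonempty) :
    ∃ l : List V, l.IsChain H.Adj ∧ l.Nodup ∧ (∀ x ∈ l, x ∈ S) ∧
      (2 * d ≤ l.length ∨
        d + 1 ≤ l.length ∧ ∀ x ∈ l, ∀ y, H.Adj x y → y ∈ l) := by
  classical
  let p : ℕ → Prop := fun m =>
    ∃ l : List V, l.length = m ∧ l.IsChain H.Adj ∧ l.Nodup ∧ ∀ x ∈ l, x ∈ S
  have hbd : ∀ m, p m → m ≤ Fintype.card V := by
    rintro m ⟨l, rfl, -, hn, -⟩
    exact hn.length_le_card
  obtain ⟨v, hv⟩ := hne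
  have hp1 : p 1 := ⟨[v], by simp, by simp, by simp, by simpa using hv⟩
  have hmax : ∀ m, p m → m ≤ Nat.findGreatest p (Fintype.card V) := fun m hm =>
    Nat.le_findGreatest (hbd m hm) hm
  obtain ⟨l, hl, hc, hn, hlS⟩ := Nat.findGreatest_spec (hbd 1 hp1) hp1
  rw [← hl] at hmax
  have hpos : 0 < l.length := hmax 1 hp1
  -- No path on as many vertices can be prolonged at its first vertex.
  have hext : ∀ (c : List V) (x : V), (x :: c).length = l.length → (x :: c).IsChain H.Adj →
      (x :: c).Nodup → (∀ z ∈ x :: c, z ∈ S) → ∀ y, H.Adj x y → y ∈ x :: c := by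
    intro c x hlen hcc hcn hcS y hxy
    by_contra hy
    have := hmax (l.length + 1) ⟨y :: x :: c, by rw [List.length_cons, hlen],
      List.isChain_cons_cons.2 ⟨hxy.symm, hcc⟩, List.nodup_cons.2 ⟨hy, hcn⟩, by
        intro z hz
        rcases List.mem_cons.1 hz with rfl | hz
        · exact hS x (hcS x (by simp)) _ hxy
        · exact hcS z hz⟩
    omega
  have hhead : ∀ y, H.Adj l[0] y → y ∈ l := by
    obtain ⟨x, c, rfl⟩ := List.exists_cons_of_length_pos hpos
    exact hext c x rfl hc hn hlS
  have hlast : ∀ y, H.Adj l[l.length - 1] y → y ∈ l := by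
    have hr : 0 < l.reverse.length := by simpa using hpos
    obtain ⟨x, c, hxc⟩ := List.exists_cons_of_length_pos hr
    have hx : l[l.length - 1] = x := by
      have : l.reverse[0] = x := by simp [hxc]
      simpa using this
    intro y hy
    rw [← List.mem_reverse, hxc]
    refine hext c x (by rw [← hxc, List.length_reverse]) ?_ ?_ ?_ y (hx ▸ hy)
    · rw [← hxc, List.isChain_reverse]
      exact hc.imp fun a b h => h.symm
    · rw [← hxc]; exact List.nodup_reverse.2 hn
    · rw [← hxc]; simpa using hlS
  let A := (range (l.length - 1)).filter fun i => ∃ h : i + 1 < l.length, H.Adj l[0] l[i + 1]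
  let B := (range (l.length - 1)).filter
    fun i => ∃ h : i < l.length, H.Adj l[l.length - 1] l[i]
  have hA : d ≤ A.card := by
    refine (hd l[0]).trans ?_
    rw [← SimpleGraph.card_neighborFinset_eq_degree]
    refine card_le_card_of_surjOn (fun i => if h : i + 1 < l.length then l[i + 1] else l[0]) ?_
    intro y hy
    have hy : H.Adj l[0] y := by simpa using hy
    obtain ⟨i, hi, rfl⟩ := List.getElem_of_mem (hhead y hy)
    obtain _ | i := i
    · exact absurd hy (H.irrefl)
    · refine ⟨i, ?_, by simp [hi]⟩
      simp only [A, coe_filter, mem_range, Set.mem_ofPred_eq]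
      exact ⟨by omega, hi, hy⟩
  have hB : d ≤ B.card := by
    refine (hd l[l.length - 1]).trans ?_
    rw [← SimpleGraph.card_neighborFinset_eq_degree]
    refine card_le_card_of_surjOn (fun i => if h : i < l.length then l[i] else l[0]) ?_
    intro y hy
    have hy : H.Adj l[l.length - 1] y := by simpa using hy
    obtain ⟨i, hi, rfl⟩ := List.getElem_of_mem (hlast y hy)
    refine ⟨i, ?_, by simp [hi]⟩
    simp only [B, coe_filter, mem_range, Set.mem_ofPred_eq]
    refine ⟨?_, hi, hy⟩
    by_contra hcon
    obtain rfl : i = l.length - 1 := by omega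
    exact H.irrefl hy
  refine ⟨l, hc, hn, hlS, or_iff_not_imp_left.2 fun hlt => ⟨?_, ?_⟩⟩
  · have := hA.trans (card_filter_le _ _)
    rw [card_range] at this
    omega
  obtain ⟨i, hiA, hiB⟩ : ∃ i, i ∈ A ∧ i ∈ B := by
    by_contra! hdis
    have h1 := card_union_of_disjoint (disjoint_left.2 hdis)
    have h2 : (A ∪ B).card ≤ (range (l.length - 1)).card :=
      card_le_card (union_subset (filter_subset _ _) (filter_subset _ _))
    rw [card_range] at h2
    omega
  obtain ⟨-, hi, hadj0⟩ := mem_filter.1 hiA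
  obtain ⟨-, _, hadj1⟩ := mem_filter.1 hiB
  obtain ⟨c, hperm, hcc, hwrap⟩ := exists_cyclic_reordering H hc hi hadj0 hadj1
  intro x hx y hxy
  obtain ⟨a, b, hab⟩ := List.append_of_mem (hperm.mem_iff.2 hx)
  have hrot : (x :: (b ++ a)).Perm l := by
    refine List.Perm.trans ?_ hperm
    rw [hab]
    exact (List.perm_append_comm (l₁ := x :: b) (l₂ := a))
  rw [hab] at hcc hwrap
  obtain ⟨hca, hcb, -⟩ := List.isChain_append.1 hcc
  refine hrot.mem_iff.1 (hext (b ++ a) x hrot.length_eq ?_ (hrot.nodup_iff.2 hn)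
    (fun z hz => hlS z (hrot.mem_iff.1 hz)) y hxy)
  refine List.isChain_append (l₁ := x :: b) (l₂ := a) |>.2 ⟨hcb, hca, ?_⟩
  intro u hu w hw
  refine hwrap u ?_ w ?_
  · simpa [List.getLast?_append] using hu
  · cases a <;> simp_all

/-- Two disjoint paths that together provide `d` disjoint edges. -/
lemma exists_two_disjoint_paths {V : Type*} [Fintype V] (H : SimpleGraph V) [DecidableRel H.Adj]
    {d : ℕ} (hd : ∀ v, d ≤ H.degree v) (hV : 2 * d < Fintype.card V) :
    ∃ P Q : List V, P.IsChain H.Adj ∧ P.Nodup ∧ Q.IsChain H.Adj ∧ Q.Nodup ∧ P.Disjoint Q ∧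
      d ≤ P.length / 2 + Q.length / 2 := by
  classical
  have : Nonempty V := Fintype.card_pos_iff.1 (by omega)
  obtain ⟨P, hPc, hPn, -, hP⟩ := exists_long_or_closed_path H hd Set.univ (by simp)
    Set.univ_nonempty
  by_cases hlong : 2 * d ≤ P.length
  · exact ⟨P, [], hPc, hPn, by simp, by simp, by simp, by simp; omega⟩
  obtain ⟨hPd, hPcl⟩ := hP.resolve_left hlong
  obtain ⟨v, hv⟩ : ∃ v, v ∉ P := by
    by_contra! hall
    have h1 : P.toFinset = univ := eq_univ_iff_forall.2 fun v => List.mem_toFinset.2 (hall v)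
    have h2 := List.toFinset_card_of_nodup hPn
    rw [h1, card_univ] at h2
    omega
  obtain ⟨Q, hQc, hQn, hQS, hQ⟩ := exists_long_or_closed_path H hd {x | x ∉ P}
    (fun x hx y hxy hy => hx (hPcl y hy x hxy.symm)) ⟨v, hv⟩
  refine ⟨P, Q, hPc, hPn, hQc, hQn, fun x hx hx' => hQS x hx' hx, ?_⟩
  omega

/-- An acyclicity criterion for graphs on few vertices. -/
lemma isAcyclic_of_no_short_cycle {V : Type*} [Fintype V] (G : SimpleGraph V)
    (hV : Fintype.card V ≤ 4)
    (h3 : ∀ a b c, G.Adj a b → G.Adj b c → G.Adj c a → False)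
    (h4 : ∀ a b c d, a ≠ c → b ≠ d → G.Adj a b → G.Adj b c → G.Adj c d → G.Adj d a → False) :
    G.IsAcyclic := by
  intro v p hp
  have hlen : p.length ≤ 4 := by
    have := hp.support_nodup.length_le_card
    simp at this
    omega
  have hthree := hp.three_le_length
  have hnd := hp.support_nodup
  match p, hlen, hthree, hnd with
  | .cons h₁ (.cons h₂ (.cons h₃ .nil)), _, _, _ => exact h3 _ _ _ h₁ h₂ h₃
  | .cons h₁ (.cons h₂ (.cons h₃ (.cons h₄ .nil))), _, _, hnd =>
    simp at hnd
    exact h4 _ _ _ _ (by grind) (by grind) h₁ h₂ h₃ h₄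
  | .cons h₁ (.cons h₂ (.cons h₃ (.cons h₄ (.cons h₅ q)))), hlen, _, _ =>
    simp only [SimpleGraph.Walk.length_cons] at hlen
    omega

/-- A set of at most four vertices induces a linear forest as soon as it contains a suitable path
of the complement: an edge for three vertices, a Hamiltonian path for four. -/
lemma isLinearForest_induce_of_compl_path {V : Type*} (G : SimpleGraph V) (A : Finset V)
    (hA : A.card ≤ 4) (T : List V) (hTc : T.IsChain Gᶜ.Adj) (hTn : T.Nodup)
    (hTl : T.length = 2 * (A.card - 2)) (hTA : ∀ x ∈ T, x ∈ A) :
    (G.induce (↑A : Set V)).IsLinearForest := by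
  classical
  have eq_of_mem_of_card_three : ∀ a ∈ A, ∀ b ∈ A, ∀ c ∈ A, a ≠ b → b ≠ c → c ≠ a →
      ∀ x ∈ A, A.card = 3 → x = a ∨ x = b ∨ x = c := by
    intro a ha b hb c hc hab hbc hca x hx h
    have : ({a, b, c} : Finset V) = A := eq_of_subset_of_card_le
      (by simp [insert_subset_iff, ha, hb, hc]) (by
      rw [card_eq_three.2 ⟨a, b, c, hab, hca.symm, hbc, rfl⟩]; omega)
    simpa [← this] using hx
  have eq_of_mem_of_four : ∀ a ∈ A, ∀ b ∈ A, ∀ c ∈ A, ∀ d ∈ A, [a, b, c, d].Nodup →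
      A.card = 4 ∧ ∀ x ∈ A, x = a ∨ x = b ∨ x = c ∨ x = d := by
    intro a ha b hb c hc d hd hn
    have hcard := List.toFinset_card_of_nodup hn
    have hsub : [a, b, c, d].toFinset ⊆ A := by
      intro x hx
      simp at hx
      grind
    have hle := card_le_card hsub
    simp only [List.length_cons, List.length_nil] at hcard
    have heq := eq_of_subset_of_card_le hsub (by omega)
    refine ⟨by omega, fun x hx => ?_⟩
    rw [← heq] at hx
    simpa using hx
  have three_le : ∀ a ∈ A, ∀ b ∈ A, ∀ c ∈ A, a ≠ b → b ≠ c → c ≠ a → 3 ≤ A.card := by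
    intro a ha b hb c hc hab hbc hca
    rw [← card_eq_three.2 ⟨a, b, c, hab, hca.symm, hbc, rfl⟩]
    exact card_le_card (by simp [insert_subset_iff, ha, hb, hc])
  have htri : ∀ a ∈ A, ∀ b ∈ A, ∀ c ∈ A, G.Adj a b → G.Adj b c → G.Adj c a → False := by
    intro a ha b hb c hc hab hbc hca
    have h3 := three_le a ha b hb c hc hab.ne hbc.ne hca.ne
    obtain h | h : A.card = 3 ∨ A.card = 4 := by omega
    · rw [h] at hTl
      obtain ⟨w, x, rfl⟩ := List.length_eq_two.1 hTl
      have hw := eq_of_mem_of_card_three a ha b hb c hc hab.ne hbc.ne hca.ne w (hTA w (by simp)) h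
      have hx := eq_of_mem_of_card_three a ha b hb c hc hab.ne hbc.ne hca.ne x (hTA x (by simp)) h
      simp at hTc
      clear eq_of_mem_of_card_three eq_of_mem_of_four three_le hTA
      grind [SimpleGraph.adj_comm]
    · rw [h] at hTl
      obtain ⟨w, x, y, z, rfl⟩ : ∃ w x y z, T = [w, x, y, z] := by
        match T, hTl with
        | [w, x, y, z], _ => exact ⟨w, x, y, z, rfl⟩
      have hk := (eq_of_mem_of_four w (hTA w (by simp)) x (hTA x (by simp)) y (hTA y (by simp))
        z (hTA z (by simp)) hTn).2
      have := hk a ha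
      have := hk b hb
      have := hk c hc
      have := hab.ne
      have := hbc.ne
      have := hca.ne
      simp at hTc
      clear eq_of_mem_of_card_three eq_of_mem_of_four three_le hTA
      grind [SimpleGraph.adj_comm]
  have hfour : ∀ a ∈ A, ∀ b ∈ A, ∀ c ∈ A, ∀ d ∈ A, [a, b, c, d].Nodup →
      ∃ w x y z, [w, x, y, z].Nodup ∧ ¬ G.Adj w x ∧ ¬ G.Adj x y ∧ ¬ G.Adj y z ∧
        ∀ u ∈ [w, x, y, z], u = a ∨ u = b ∨ u = c ∨ u = d := by
    intro a ha b hb c hc d hd hn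
    obtain ⟨h, hk⟩ := eq_of_mem_of_four a ha b hb c hc d hd hn
    rw [h] at hTl
    match T, hTl with
    | [w, x, y, z], _ =>
      simp only [List.isChain_cons_cons, SimpleGraph.compl_adj] at hTc
      exact ⟨w, x, y, z, hTn, hTc.1.2, hTc.2.1.2, hTc.2.2.1.2, fun u hu => hk u (hTA u hu)⟩
  refine ⟨isAcyclic_of_no_short_cycle _ (by simpa using hA) ?_ ?_, ?_⟩
  · rintro ⟨a, ha⟩ ⟨b, hb⟩ ⟨c, hc⟩ hab hbc hca
    exact htri a ha b hb c hc hab hbc hca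
  · rintro ⟨a, ha⟩ ⟨b, hb⟩ ⟨c, hc⟩ ⟨d, hd⟩ hac hbd hab hbc hcd hda
    replace hab : G.Adj a b := hab
    replace hbc : G.Adj b c := hbc
    replace hcd : G.Adj c d := hcd
    replace hda : G.Adj d a := hda
    have hac : a ≠ c := fun h => hac (Subtype.ext h)
    have hbd : b ≠ d := fun h => hbd (Subtype.ext h)
    have := hab.ne
    have := hbc.ne
    have := hcd.ne
    have := hda.ne
    obtain ⟨w, x, y, z, hn, h1, h2, h3, hk⟩ := hfour a ha b hb c hc d hd (by simp; grind)
    simp at hn hk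
    clear eq_of_mem_of_card_three eq_of_mem_of_four three_le hTA htri hfour
    grind [SimpleGraph.adj_comm]
  · rintro ⟨v, hv⟩ ⟨a, ha⟩ ⟨b, hb⟩ ⟨c, hc⟩ hva hvb hvc
    replace hva : G.Adj v a := hva
    replace hvb : G.Adj v b := hvb
    replace hvc : G.Adj v c := hvc
    simp only [Subtype.mk.injEq]
    by_contra! hne
    have := hva.ne
    have := hvb.ne
    have := hvc.ne
    obtain ⟨w, x, y, z, hn, h1, h2, h3, hk⟩ := hfour v hv a ha b hb c hc (by simp; grind)
    simp at hn hk
    clear eq_of_mem_of_card_three eq_of_mem_of_four three_le hTA htri hfour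
    grind [SimpleGraph.adj_comm]

/-- The balanced sizes `⌊n / k⌋` and `⌊n / k⌋ + 1` add up to `n`. -/
lemma sum_balanced_sizes (n k : ℕ) (hk : 0 < k) :
    ∑ i : Fin k, (n / k + if (i : ℕ) < n % k then 1 else 0) = n := by
  have hlt := Nat.mod_lt n hk
  rw [sum_add_distrib, sum_const, card_univ, Fintype.card_fin, smul_eq_mul,
    Fin.sum_univ_eq_sum_range (fun i => if i < n % k then 1 else 0), ← card_filter]
  have : (range k).filter (fun i => i < n % k) = range (n % k) := by
    ext i
    simp only [mem_filter, mem_range]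
    omega
  rw [this, card_range]
  exact Nat.div_add_mod n k

/-- Disjoint paths with prescribed even orders `2 * w i`, `w i ≤ 2`, in a graph of large minimum
degree. -/
lemma exists_disjoint_paths_of_minDegree {V ι : Type*} [Fintype V] [Fintype ι]
    (H : SimpleGraph V) [DecidableRel H.Adj] (w : ι → ℕ) (hw : ∀ i, w i ≤ 2)
    {i₀ : ι} (h₀ : w i₀ = 1) (hd : ∀ v, ∑ i, w i ≤ H.degree v)
    (hV : 2 * ∑ i, w i < Fintype.card V) :
    ∃ T : ι → List V, (∀ i, (T i).IsChain H.Adj ∧ (T i).Nodup ∧ (T i).length = 2 * w i) ∧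
      Pairwise fun i j => (T i).Disjoint (T j) := by
  classical
  obtain ⟨P, Q, hPc, hPn, hQc, hQn, hPQ, hlen⟩ := exists_two_disjoint_paths H hd hV
  obtain ⟨A, hA⟩ := exists_sum_eq_of_le_two w hw h₀
    (min_le_right (P.length / 2) (∑ i, w i))
  have hAc := sum_add_sum_compl A w
  obtain ⟨T₁, h₁, hd₁⟩ := exists_disjoint_subpaths H (fun i => 2 * w i) A P hPc hPn (by
    rw [← mul_sum]; omega)
  obtain ⟨T₂, h₂, hd₂⟩ := exists_disjoint_subpaths H (fun i => 2 * w i) Aᶜ Q hQc hQn (by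
    rw [← mul_sum]; omega)
  refine ⟨fun i => if i ∈ A then T₁ i else T₂ i, fun i => ?_, fun i j hij => ?_⟩
  · by_cases hi : i ∈ A
    · simpa only [if_pos hi] using ⟨(h₁ i hi).1, (h₁ i hi).2.1, (h₁ i hi).2.2.1⟩
    · have := h₂ i (mem_compl.2 hi)
      simpa only [if_neg hi] using ⟨this.1, this.2.1, this.2.2.1⟩
  · have hcross : ∀ i ∈ A, ∀ j ∉ A, (T₁ i).Disjoint (T₂ j) := fun i hi j hj x hx hx' =>
      hPQ ((h₁ i hi).2.2.2 hx) ((h₂ j (mem_compl.2 hj)).2.2.2 hx')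
    by_cases hi : i ∈ A <;> by_cases hj : j ∈ A <;> simp only [hi, hj, if_true, if_false]
    · exact hd₁ i hi j hj hij
    · exact hcross i hi j hj
    · exact (hcross j hj i hi).symm
    · exact hd₂ i (mem_compl.2 hi) j (mem_compl.2 hj) hij

theorem equitable_partition_induced_linear_forests
    {V : Type*} [Fintype V] (G : SimpleGraph V) [DecidableRel G.Adj]
    (hΔ : ((Fintype.card V : ℚ) - 1) / 2 ≤ (G.maxDegree : ℚ))
    (k : ℕ) (hk : (⌈((G.maxDegree : ℚ) + 1) / 2⌉ : ℤ) ≤ (k : ℤ)) :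
    ∃ P : Fin k → Finset V,
      (∀ v : V, ∃! i : Fin k, v ∈ P i) ∧
      (∀ i j : Fin k, (P i).card ≤ (P j).card + 1) ∧
      (∀ i : Fin k, (G.induce (↑(P i) : Set V)).IsLinearForest) := by
  classical
  have hΔ' : Fintype.card V ≤ 2 * G.maxDegree + 1 := by
    have : (Fintype.card V : ℚ) ≤ 2 * G.maxDegree + 1 := by linarith
    exact_mod_cast this
  have hk' : G.maxDegree + 1 ≤ 2 * k := by
    have h := Int.ceil_le.1 hk
    have : (G.maxDegree : ℚ) + 1 ≤ 2 * k := by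
      push_cast at h
      linarith
    exact_mod_cast this
  have hk0 : 0 < k := by omega
  obtain ⟨n, hn⟩ : ∃ n, n = Fintype.card V := ⟨_, rfl⟩
  rw [← hn] at hΔ'
  let q : Fin k → ℕ := fun i => n / k + if (i : ℕ) < n % k then 1 else 0
  have hqsum : ∑ i, q i = n := sum_balanced_sizes n k hk0
  have hdm := Nat.div_add_mod n k
  have hmod := Nat.mod_lt n hk0
  have hq4 : ∀ i, q i ≤ 4 := fun i => by
    have : n / k < 4 := (Nat.div_lt_iff_lt_mul hk0).2 (by omega)
    simp only [q]
    split_ifs <;> omega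
  have hqq : ∀ i j, q i ≤ q j + 1 := fun i j => by
    simp only [q]
    split_ifs <;> omega
  obtain ⟨T, hT, hTd⟩ : ∃ T : Fin k → List V,
      (∀ i, (T i).IsChain Gᶜ.Adj ∧ (T i).Nodup ∧ (T i).length = 2 * (q i - 2)) ∧
      Pairwise fun i j => (T i).Disjoint (T j) := by
    by_cases hsmall : n ≤ 2 * k
    · have hq2 : ∀ i, q i ≤ 2 := fun i => by
        simp only [q]
        have : n / k ≤ 2 := Nat.div_le_of_le_mul (by omega)
        obtain h | h : n / k ≤ 1 ∨ n / k = 2 := by omega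
        · split_ifs <;> omega
        · rw [h] at hdm ⊢
          have : n % k = 0 := by omega
          simp [this]
      refine ⟨fun _ => [], fun i => ⟨by simp, by simp, ?_⟩, fun i j _ => by simp⟩
      have := hq2 i
      simp only [List.length_nil]
      omega
    · have hdiv2 : 2 ≤ n / k := (Nat.le_div_iff_mul_le hk0).2 (by omega)
      have hdiv4 : n / k < 4 := (Nat.div_lt_iff_lt_mul hk0).2 (by omega)
      have hwsum : ∑ i, (q i - 2) = n - 2 * k := by
        have h : ∑ i, (q i - 2) + ∑ _i : Fin k, 2 = ∑ i, q i := by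
          rw [← sum_add_distrib]
          refine sum_congr rfl fun i _ => ?_
          have : 2 ≤ q i := hdiv2.trans (Nat.le_add_right _ _)
          omega
        rw [hqsum, sum_const, card_univ, Fintype.card_fin, smul_eq_mul] at h
        omega
      obtain ⟨i₀, hi₀⟩ : ∃ i₀, q i₀ - 2 = 1 := by
        obtain h | h : n / k = 2 ∨ n / k = 3 := by omega
        · refine ⟨⟨0, hk0⟩, ?_⟩
          rw [h] at hdm
          simp only [q, h]
          rw [if_pos (by omega)]
        · refine ⟨⟨k - 1, by omega⟩, ?_⟩
          rw [h] at hdm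
          simp only [q, h]
          rw [if_neg (by omega)]
      refine exists_disjoint_paths_of_minDegree Gᶜ (fun i => q i - 2)
        (fun i => by have := hq4 i; omega) hi₀ (fun v => ?_) ?_
      · rw [hwsum, SimpleGraph.degree_compl, ← hn]
        have := G.degree_le_maxDegree v
        omega
      · rw [hwsum, ← hn]
        omega
  obtain ⟨P, hTP, hPq, hP⟩ := exists_partition_extending q (hqsum.trans hn)
    (fun i => (T i).toFinset)
    (fun i j hij => List.disjoint_toFinset_iff_disjoint.2 (hTd hij))
    (fun i => by
      rw [List.toFinset_card_of_nodup (hT i).2.1, (hT i).2.2]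
      have := hq4 i
      omega)
  refine ⟨P, hP, fun i j => by rw [hPq, hPq]; exact hqq i j, fun i => ?_⟩
  refine isLinearForest_induce_of_compl_path G (P i) ((hPq i).trans_le (hq4 i)) (T i) (hT i).1
    (hT i).2.1 (by rw [hPq]; exact (hT i).2.2) fun x hx => hTP i (List.mem_toFinset.2 hx)
end

section
/- Let G be a finite simple connected graph with minimum degree δ(G) ≤ (|V(G)|-1)/2. Then G contains a path of length 2δ(G), i.e., a path with 2δ(G) edges (equivalently, 2δ(G)+1 vertices). -/
namespace SimpleGraph

variable {V : Type*} {G : SimpleGraph V}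

/-- In a connected graph, if the ends of a non-spanning path are adjacent, then there is a path
with one more edge. -/
theorem Connected.exists_isPath_length_succ_of_adj_ends (hconn : G.Connected) {u v z : V}
    {p : G.Walk u v} (hp : p.IsPath) (hvu : G.Adj v u) (hz : z ∉ p.support) :
    ∃ (a b : V) (q : G.Walk a b), q.IsPath ∧ q.length = p.length + 1 := by
  classical
  obtain ⟨r⟩ := hconn.preconnected u z
  obtain ⟨d, -, hx, hw⟩ := r.exists_boundary_dart {x | x ∈ p.support} p.start_mem_support hz
  have hxc : d.fst ∈ (Walk.cons hvu p).support := List.mem_cons_of_mem _ hx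
  have hsupp := ((Walk.cons hvu p).support_rotate d.fst hxc).perm
  have hlen := (Walk.cons hvu p).length_rotate d.fst hxc
  rw [Walk.support_cons, List.tail_cons] at hsupp
  generalize (Walk.cons hvu p).rotate d.fst hxc = c at hsupp hlen
  cases c with
  | nil => simp at hlen
  | cons h q =>
    rw [Walk.support_cons, List.tail_cons] at hsupp
    have hq : q.IsPath := .mk' (hsupp.nodup_iff.mpr hp.support_nodup)
    refine ⟨_, _, q.concat d.adj, hq.concat (fun hmem => hw (hsupp.mem_iff.mp hmem)) d.adj, ?_⟩
    simpa using hlen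

/-- If the start of a path is adjacent to the successor of a neighbour of its end, then the
vertices of the path can be reordered to form a path with adjacent ends. -/
theorem Walk.IsPath.exists_adj_ends {u v : V} {p : G.Walk u v} (hp : p.IsPath) {i : ℕ}
    (hi : i < p.length) (hu : G.Adj u (p.getVert (i + 1))) (hv : G.Adj v (p.getVert i)) :
    ∃ (b : V) (q : G.Walk u b), q.IsPath ∧ G.Adj b u ∧ q.support.Perm p.support := by
  let q := (p.take i).append (.cons hv.symm (p.drop (i + 1)).reverse)
  have hq : q.support.Perm p.support := by
    simp only [q, Walk.support_append, Walk.support_cons, List.tail_cons, Walk.support_reverse,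
      Walk.support_take, Walk.drop_support_eq_support_drop_min,
      min_eq_left (Nat.succ_le_of_lt hi)]
    refine ((List.reverse_perm _).append_left _).trans ?_
    rw [List.take_append_drop]
  exact ⟨_, q, .mk' (hq.nodup_iff.mpr hp.support_nodup), hu.symm, hq⟩

/-- A path all of whose end-neighbours lie on it, with fewer edges than the sum of the degrees of
its ends, has an edge whose ends are crosswise adjacent to the ends of the path. -/
theorem Walk.exists_crossing_of_length_lt_degree_add_degree [Fintype V] [DecidableRel G.Adj]
    {u v : V} {p : G.Walk u v} (hu : ∀ w, G.Adj u w → w ∈ p.support)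
    (hv : ∀ w, G.Adj v w → w ∈ p.support) (hlen : p.length < G.degree u + G.degree v) :
    ∃ i < p.length, G.Adj u (p.getVert (i + 1)) ∧ G.Adj v (p.getVert i) := by
  classical
  let A := {i ∈ Finset.range p.length | G.Adj u (p.getVert (i + 1))}
  let B := {i ∈ Finset.range p.length | G.Adj v (p.getVert i)}
  have hA : G.degree u ≤ A.card := by
    refine (Finset.card_le_card fun w hw => ?_).trans
      (Finset.card_image_le (s := A) (f := fun i => p.getVert (i + 1)))
    rw [mem_neighborFinset] at hw
    obtain ⟨n, rfl, hn⟩ := Walk.mem_support_iff_exists_getVert.mp (hu w hw)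
    cases n with
    | zero => simp at hw
    | succ n => exact Finset.mem_image.mpr ⟨n, by simp [A, hw]; omega, rfl⟩
  have hB : G.degree v ≤ B.card := by
    refine (Finset.card_le_card fun w hw => ?_).trans
      (Finset.card_image_le (s := B) (f := p.getVert))
    rw [mem_neighborFinset] at hw
    obtain ⟨n, rfl, hn⟩ := Walk.mem_support_iff_exists_getVert.mp (hv w hw)
    have hne : n ≠ p.length := by
      rintro rfl
      simp at hw
    exact Finset.mem_image.mpr ⟨n, by simp [B, hw]; omega, rfl⟩
  have hAB : (A ∩ B).Nonempty := by
    refine Finset.inter_nonempty_of_card_lt_card_add_card (s := Finset.range p.length)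
      (Finset.filter_subset _ _) (Finset.filter_subset _ _) ?_
    rw [Finset.card_range]
    omega
  obtain ⟨i, hi⟩ := hAB
  simp only [A, B, Finset.mem_inter, Finset.mem_filter, Finset.mem_range] at hi
  exact ⟨i, hi.1.1, hi.1.2, hi.2.2⟩

/-- In a connected graph, a non-spanning path with fewer than `2 * G.minDegree` edges can be
replaced by one with one more edge. -/
theorem Connected.exists_isPath_length_succ [Fintype V] [DecidableRel G.Adj]
    (hconn : G.Connected) {u v : V} {p : G.Walk u v} (hp : p.IsPath)
    (hdeg : p.length < 2 * G.minDegree) (hcard : p.length + 1 < Fintype.card V) :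
    ∃ (a b : V) (q : G.Walk a b), q.IsPath ∧ q.length = p.length + 1 := by
  classical
  by_cases hu : ∀ w, G.Adj u w → w ∈ p.support
  · by_cases hv : ∀ w, G.Adj v w → w ∈ p.support
    · have hdu := G.minDegree_le_degree u
      have hdv := G.minDegree_le_degree v
      obtain ⟨i, hi, hui, hvi⟩ :=
        Walk.exists_crossing_of_length_lt_degree_add_degree hu hv (by omega)
      obtain ⟨b, q, hq, hbu, hperm⟩ := hp.exists_adj_ends hi hui hvi
      have hqp : q.length = p.length := by simpa using hperm.length_eq
      obtain ⟨z, hz⟩ : ∃ z, z ∉ q.support := by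
        by_contra! hall
        have huniv : q.support.toFinset = Finset.univ := by
          ext x
          simpa using hall x
        have := q.support.toFinset_card_le
        rw [huniv, Finset.card_univ, Walk.length_support] at this
        omega
      exact hqp ▸ hconn.exists_isPath_length_succ_of_adj_ends hq hbu hz
    · push Not at hv
      obtain ⟨w, hvw, hw⟩ := hv
      exact ⟨_, _, p.concat hvw, hp.concat hw hvw, by simp⟩
  · push Not at hu
    obtain ⟨w, huw, hw⟩ := hu
    exact ⟨_, _, .cons huw.symm p, hp.cons hw, by simp⟩

end SimpleGraph

theorem connected_graph_contains_path_of_length_two_minDegree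
    {V : Type*} [Fintype V] (G : SimpleGraph V) [DecidableRel G.Adj]
    (hconn : G.Connected)
    (hδ : (G.minDegree : ℚ) ≤ ((Fintype.card V : ℚ) - 1) / 2) :
    ∃ (u v : V) (p : G.Walk u v), p.IsPath ∧ p.length = 2 * G.minDegree := by
  have hcard : 2 * G.minDegree + 1 ≤ Fintype.card V := by
    have : (2 * G.minDegree + 1 : ℚ) ≤ Fintype.card V := by linarith
    exact_mod_cast this
  suffices ∀ k ≤ 2 * G.minDegree, ∃ (u v : V) (p : G.Walk u v), p.IsPath ∧ p.length = k from
    this _ le_rfl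
  intro k
  induction k with
  | zero =>
    obtain ⟨u⟩ := hconn.nonempty
    exact fun _ => ⟨u, u, .nil, .nil, rfl⟩
  | succ k ih =>
    intro hk
    obtain ⟨u, v, p, hp, rfl⟩ := ih (by omega)
    exact hconn.exists_isPath_length_succ hp (by omega) (by omega)
end

section
/- Let G be a finite simple connected graph with |V(G)| > 2δ(G). Then the matching number of G satisfies α'(G) ≥ δ(G). -/
namespace SimpleGraph

variable {V : Type*} {G : SimpleGraph V}

/-- An involution of the vertices that moves vertices only along edges; its 2-cycles form a
matching. -/
structure IsMatchingInvolution (G : SimpleGraph V) (f : V → V) : Prop where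
  involutive : Function.Involutive f
  adj : ∀ v, f v ≠ v → G.Adj v (f v)

namespace IsMatchingInvolution

variable {f : V → V}

/-- The subgraph whose edges are the 2-cycles of a matching involution. -/
def toSubgraph (hf : G.IsMatchingInvolution f) : G.Subgraph where
  verts := {v | f v ≠ v}
  Adj a b := f a = b ∧ f a ≠ a
  adj_sub := by
    rintro a b ⟨rfl, h⟩
    exact hf.adj a h
  edge_vert h := h.2
  symm := ⟨by
    rintro a b ⟨rfl, h⟩
    rw [hf.involutive a]
    exact ⟨rfl, h.symm⟩⟩

lemma isMatching_toSubgraph (hf : G.IsMatchingInvolution f) : hf.toSubgraph.IsMatching :=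
  fun v hv => ⟨f v, ⟨rfl, hv⟩, fun _ h => h.1.symm⟩

variable [Fintype V] [DecidableEq V]

lemma card_support_le (hf : G.IsMatchingInvolution f) :
    (Finset.univ.filter fun v => f v ≠ v).card ≤ 2 * hf.toSubgraph.edgeSet.ncard := by
  set S := Finset.univ.filter fun v => f v ≠ v
  have hfiber : S.card ≤ 2 * (S.image fun v => s(v, f v)).card := by
    refine Finset.card_le_mul_card_image S 2 fun e he => ?_
    obtain ⟨a, -, rfl⟩ := Finset.mem_image.1 he
    refine (Finset.card_le_card (t := {a, f a}) fun b hb => ?_).trans Finset.card_le_two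
    have := (Finset.mem_filter.1 hb).2
    simp only [Sym2.eq_iff] at this
    simp only [Finset.mem_insert, Finset.mem_singleton]
    tauto
  have himage : (S.image fun v => s(v, f v)).card ≤ hf.toSubgraph.edgeSet.ncard := by
    rw [← Set.ncard_coe_finset]
    refine Set.ncard_le_ncard (fun e he => ?_) (Set.toFinite _)
    obtain ⟨a, ha, rfl⟩ := Finset.mem_image.1 (Finset.mem_coe.1 he)
    exact ⟨rfl, (Finset.mem_filter.1 ha).2⟩
  omega

/-- In a matching involution of maximum support, the degrees of two fixed vertices add up to at
most the size of the support. -/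
lemma degree_add_degree_le [DecidableRel G.Adj] (hf : G.IsMatchingInvolution f)
    (hmax : ∀ g, G.IsMatchingInvolution g →
      (Finset.univ.filter fun v => g v ≠ v).card ≤ (Finset.univ.filter fun v => f v ≠ v).card)
    {u v : V} (hu : f u = u) (hv : f v = v) (huv : u ≠ v) :
    G.degree u + G.degree v ≤ (Finset.univ.filter fun v => f v ≠ v).card := by
  have no_extension : ∀ g, G.IsMatchingInvolution g → (∀ a, f a ≠ a → g a ≠ a) →
      ∀ w, f w = w → g w = w := by
    intro g hg hsub w hw
    by_contra hgw
    refine (hmax g hg).not_gt (Finset.card_lt_card (Finset.ssubset_iff_of_subset ?_ |>.2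
      ⟨w, by simpa using hgw, by simpa using hw⟩))
    intro a
    simpa using hsub a
  have hinv : ∀ a, f (f a) = a := hf.involutive
  have neighbor_moved : ∀ w x, f w = w → G.Adj w x → f x ≠ x := by
    intro w x hw hwx hx
    have hne := hwx.ne
    have hxw := hwx.symm
    have := no_extension (fun a => if a = w then x else if a = x then w else f a)
      ⟨fun a => by grind, fun a => by have := hf.adj a; grind⟩ (by grind) w hw
    grind
  have no_augmenting_path : ∀ x, G.Adj u x → ¬ G.Adj v (f x) := by
    intro x hux hvx
    have hx := neighbor_moved u x hu hux
    have hxu := hux.symm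
    have hxv := hvx.symm
    have := no_extension
      (fun a => if a = u then x else if a = x then u else
        if a = v then f x else if a = f x then v else f a)
      ⟨fun a => by have := hinv x; have := hinv a; grind,
        fun a => by have := hf.adj a; grind⟩ (by grind) u hu
    grind
  rw [← G.card_neighborFinset_eq_degree u, ← G.card_neighborFinset_eq_degree v,
    ← Finset.card_image_of_injective (G.neighborFinset u) hf.involutive.injective,
    ← Finset.card_union_of_disjoint]
  · refine Finset.card_le_card (Finset.union_subset (fun a ha => ?_) fun a ha => ?_)
    · obtain ⟨x, hx, rfl⟩ := Finset.mem_image.1 ha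
      have := neighbor_moved u x hu (by simpa using hx)
      simpa [hinv] using this.symm
    · simpa using neighbor_moved v a hv (by simpa using ha)
  · rw [Finset.disjoint_left]
    intro a ha hav
    obtain ⟨x, hx, rfl⟩ := Finset.mem_image.1 ha
    exact no_augmenting_path x (by simpa using hx) (by simpa using hav)

end IsMatchingInvolution

end SimpleGraph

theorem connected_matching_number_ge_minDegree
    {V : Type*} [Fintype V] (G : SimpleGraph V) [DecidableRel G.Adj]
    (hconn : G.Connected)
    (h : 2 * G.minDegree < Fintype.card V) :
    ∃ M : G.Subgraph, M.IsMatching ∧ G.minDegree ≤ M.edgeSet.ncard := by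
  classical
  obtain ⟨f, hf, hmax⟩ := Set.exists_max_image {f | G.IsMatchingInvolution f}
    (fun f => (Finset.univ.filter fun v => f v ≠ v).card) (Set.toFinite _)
    ⟨id, fun _ => rfl, fun _ hv => (hv rfl).elim⟩
  have hf : G.IsMatchingInvolution f := hf
  refine ⟨hf.toSubgraph, hf.isMatching_toSubgraph, ?_⟩
  have hcard := hf.card_support_le
  by_contra! hlt
  have hsplit := Finset.card_filter_add_card_filter_not (s := Finset.univ) fun v => f v = v
  rw [Finset.card_univ] at hsplit
  have hfixed : 1 < (Finset.univ.filter fun v => f v = v).card := by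
    simp only [ne_eq] at hcard
    omega
  obtain ⟨u, hu, v, hv, huv⟩ := Finset.one_lt_card.1 hfixed
  have hdeg := hf.degree_add_degree_le hmax (Finset.mem_filter.1 hu).2
    (Finset.mem_filter.1 hv).2 huv
  have := G.minDegree_le_degree u
  have := G.minDegree_le_degree v
  omega
end

section
/- Let G be a finite simple graph that is disconnected (has at least two connected components). Then the matching number of G satisfies α'(G) ≥ δ(G). -/
namespace SimpleGraph

variable {V : Type*} {G : SimpleGraph V}

/-- An involution moving every vertex either nowhere or to a neighbour: the partner map of a
matching. -/
def IsPartnerMap (G : SimpleGraph V) (f : V → V) : Prop :=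
  Function.Involutive f ∧ ∀ v, f v ≠ v → G.Adj v (f v)

/-- The matching whose vertices are those moved by a partner map. -/
def IsPartnerMap.toSubgraph {f : V → V} (hf : G.IsPartnerMap f) : G.Subgraph where
  verts := {v | f v ≠ v}
  Adj v w := f v = w ∧ v ≠ w
  adj_sub := by
    rintro v _ ⟨rfl, h⟩
    exact hf.2 v h.symm
  edge_vert := by
    rintro v _ ⟨rfl, h⟩
    exact h.symm
  symm := ⟨by
    rintro v _ ⟨rfl, h⟩
    exact ⟨hf.1 v, h.symm⟩⟩

theorem IsPartnerMap.isMatching_toSubgraph {f : V → V} (hf : G.IsPartnerMap f) :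
    hf.toSubgraph.IsMatching :=
  fun v hv => ⟨f v, ⟨rfl, Ne.symm hv⟩, fun _ hw => hw.1.symm⟩

/-- A matching covers exactly twice as many vertices as it has edges. -/
theorem Subgraph.IsMatching.ncard_verts_eq [Finite V] {M : G.Subgraph} (hM : M.IsMatching) :
    M.verts.ncard = 2 * M.edgeSet.ncard := by
  classical
  have := Fintype.ofFinite V
  have hedge : M.edgeSet.ncard = M.coe.edgeFinset.card := by
    rw [← Subgraph.image_coe_edgeSet_coe, Set.ncard_image_of_injective _
      (Sym2.map.injective Subtype.val_injective), ← coe_edgeFinset, Set.ncard_coe_finset]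
  rw [hedge, ← M.coe.sum_degrees_eq_twice_card_edges, Finset.sum_congr rfl (g := fun _ => 1),
    Finset.sum_const, smul_eq_mul, mul_one, Finset.card_univ, ← Nat.card_coe_set_eq,
    Nat.card_eq_fintype_card]
  intro v _
  rw [Subgraph.coe_degree]
  convert Subgraph.isMatching_iff_forall_degree.1 hM v v.2

variable [Fintype V] [DecidableEq V]

open Finset in
theorem IsPartnerMap.card_moved_eq {f : V → V} (hf : G.IsPartnerMap f) :
    #{v | f v ≠ v} = 2 * hf.toSubgraph.edgeSet.ncard := by
  rw [← hf.isMatching_toSubgraph.ncard_verts_eq, ← Set.ncard_coe_finset]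
  congr 1
  ext v
  simp [IsPartnerMap.toSubgraph]

open Finset in
/-- A map moving every vertex moved by `f`, and two further ones, moves at least two more. -/
theorem card_moved_add_two_le {f g : V → V} {u v : V} (huv : u ≠ v) (hu : f u = u) (hv : f v = v)
    (hgu : g u ≠ u) (hgv : g v ≠ v) (h : ∀ x, f x ≠ x → g x ≠ x) :
    #{x | f x ≠ x} + 2 ≤ #{x | g x ≠ x} := by
  rw [← card_pair huv, ← card_union_of_disjoint]
  · refine card_le_card fun x => ?_
    simp only [mem_union, mem_filter, mem_univ, true_and, mem_insert, mem_singleton]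
    rintro (hx | rfl | rfl)
    exacts [h x hx, hgu, hgv]
  · rw [Finset.disjoint_left]
    simp only [mem_filter, mem_univ, true_and, mem_insert, mem_singleton]
    rintro x hx (rfl | rfl)
    exacts [hx hu, hx hv]

open Finset in
/-- If two adjacent vertices are both unmatched, the matching can be enlarged by their edge. -/
theorem IsPartnerMap.exists_larger_of_adj {f : V → V} (hf : G.IsPartnerMap f) {u x : V}
    (hu : f u = u) (hx : f x = x) (hux : G.Adj u x) :
    ∃ g, G.IsPartnerMap g ∧ #{v | f v ≠ v} + 2 ≤ #{v | g v ≠ v} := by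
  obtain ⟨hinv, hadj⟩ := hf
  have hne := hux.ne
  have hxu := hux.symm
  refine ⟨fun y => if y = u then x else if y = x then u else f y, ⟨fun y => ?_, fun y => ?_⟩,
    card_moved_add_two_le hne hu hx ?_ ?_ fun y => ?_⟩ <;> try dsimp only
  · have := hinv y
    grind
  all_goals grind

open Finset in
/-- A matching can be enlarged along an augmenting path of length three. -/
theorem IsPartnerMap.exists_larger_of_adj_of_adj {f : V → V} (hf : G.IsPartnerMap f) {u v w : V}
    (huv : u ≠ v) (hu : f u = u) (hv : f v = v) (hw : f w ≠ w) (huw : G.Adj u w)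
    (hvw : G.Adj v (f w)) :
    ∃ g, G.IsPartnerMap g ∧ #{v | f v ≠ v} + 2 ≤ #{v | g v ≠ v} := by
  obtain ⟨hinv, hadj⟩ := hf
  have hww := hinv w
  have hwu := huw.symm
  have hwv := hvw.symm
  have huw' := huw.ne
  have hvw' := hvw.ne
  refine ⟨fun y => if y = u then w else if y = w then u else if y = v then f w else
    if y = f w then v else f y, ⟨fun y => ?_, fun y => ?_⟩,
    card_moved_add_two_le huv hu hv ?_ ?_ fun y => ?_⟩ <;> try dsimp only
  · have := hinv y
    grind
  all_goals grind

open Finset in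
/-- A matching covering fewer than `2 * δ(G)` vertices and missing at least two vertices can be
enlarged. -/
theorem IsPartnerMap.exists_larger [DecidableRel G.Adj] {f : V → V} (hf : G.IsPartnerMap f)
    (hlt : #{v | f v ≠ v} < 2 * G.minDegree) (hcard : #{v | f v ≠ v} + 2 ≤ Fintype.card V) :
    ∃ g, G.IsPartnerMap g ∧ #{v | f v ≠ v} + 2 ≤ #{v | g v ≠ v} := by
  obtain ⟨u, hu, v, hv, huv⟩ : ∃ u, f u = u ∧ ∃ v, f v = v ∧ u ≠ v := by
    have hsplit := card_filter_add_card_filter_not (s := (univ : Finset V)) (fun v => f v = v)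
    have : 1 < #{v | f v = v} := by
      rw [card_univ] at hsplit
      simp only [ne_eq] at hcard
      omega
    obtain ⟨u, hu, v, hv, huv⟩ := one_lt_card.1 this
    exact ⟨u, (mem_filter.1 hu).2, v, (mem_filter.1 hv).2, huv⟩
  by_contra hno
  have hmoved : ∀ u x, f u = u → G.Adj u x → f x ≠ x := fun u x hu hux hx =>
    hno (hf.exists_larger_of_adj hu hx hux)
  have hdisj : Disjoint (G.neighborFinset u) ((G.neighborFinset v).image f) := by
    rw [Finset.disjoint_left]
    intro w hw hw'
    obtain ⟨x, hx, rfl⟩ := mem_image.1 hw'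
    rw [mem_neighborFinset] at hw hx
    exact hno (hf.exists_larger_of_adj_of_adj huv hu hv (hmoved u _ hu hw) hw
      ((hf.1 x).symm ▸ hx))
  have hsub : G.neighborFinset u ∪ (G.neighborFinset v).image f ⊆ ({v | f v ≠ v} : Finset V) := by
    intro w hw
    rw [mem_filter_univ]
    rcases mem_union.1 hw with hw | hw
    · exact hmoved u w hu ((G.mem_neighborFinset u w).1 hw)
    · obtain ⟨x, hx, rfl⟩ := mem_image.1 hw
      rw [hf.1 x]
      exact (hmoved v x hv ((G.mem_neighborFinset v x).1 hx)).symm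
  have hle := card_le_card hsub
  rw [card_union_of_disjoint hdisj, card_image_of_injective _ hf.1.injective,
    card_neighborFinset_eq_degree, card_neighborFinset_eq_degree] at hle
  have := G.minDegree_le_degree u
  have := G.minDegree_le_degree v
  omega

open Finset in
/-- A graph on `n` vertices has a matching covering at least `2 * k` vertices whenever
`k ≤ δ(G)` and `2 * k ≤ n`. -/
theorem exists_isPartnerMap [DecidableRel G.Adj] (k : ℕ) (hk : k ≤ G.minDegree)
    (hcard : 2 * k ≤ Fintype.card V) :
    ∃ f, G.IsPartnerMap f ∧ 2 * k ≤ #{v | f v ≠ v} := by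
  induction k with
  | zero => exact ⟨id, ⟨fun _ => rfl, fun _ h => (h rfl).elim⟩, by simp⟩
  | succ k ih =>
    obtain ⟨f, hf, hfk⟩ := ih (by omega) (by omega)
    by_cases hlarge : 2 * (k + 1) ≤ #{v | f v ≠ v}
    · exact ⟨f, hf, hlarge⟩
    have heven := hf.card_moved_eq
    obtain ⟨g, hg, hgk⟩ := hf.exists_larger (by omega) (by omega)
    exact ⟨g, hg, by omega⟩

open Finset in
/-- Vertices in different components have disjoint neighbourhoods, so a disconnected graph has at
least `2 * δ(G)` vertices. -/
theorem two_mul_minDegree_le_card [DecidableRel G.Adj] (h : ¬ G.Preconnected) :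
    2 * G.minDegree ≤ Fintype.card V := by
  simp only [Preconnected, not_forall] at h
  obtain ⟨a, b, hab⟩ := h
  have hdisj : Disjoint (G.neighborFinset a) (G.neighborFinset b) := by
    rw [Finset.disjoint_left]
    intro x ha hb
    rw [mem_neighborFinset] at ha hb
    exact hab (ha.reachable.trans hb.symm.reachable)
  have hle := card_le_univ (G.neighborFinset a ∪ G.neighborFinset b)
  rw [card_union_of_disjoint hdisj, card_neighborFinset_eq_degree,
    card_neighborFinset_eq_degree] at hle
  have := G.minDegree_le_degree a
  have := G.minDegree_le_degree b
  omega

end SimpleGraph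

theorem disconnected_matching_number_ge_minDegree
    {V : Type*} [Fintype V] (G : SimpleGraph V) [DecidableRel G.Adj]
    (hdisc : ¬ G.Preconnected) :
    ∃ M : G.Subgraph, M.IsMatching ∧ G.minDegree ≤ M.edgeSet.ncard := by
  classical
  obtain ⟨f, hf, hcard⟩ := SimpleGraph.exists_isPartnerMap G.minDegree le_rfl
    (SimpleGraph.two_mul_minDegree_le_card hdisc)
  refine ⟨hf.toSubgraph, hf.isMatching_toSubgraph, ?_⟩
  rw [hf.card_moved_eq] at hcard
  omega
end

section
/- Let G be a finite simple graph with 2 ≤ δ(G) ≤ (|V(G)|-1)/2. Then G contains two vertex-disjoint paths P₁ and P₂ such that P₁ has exactly δ(G)+1 vertices and P₂ has exactly δ(G) vertices. -/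
namespace SimpleGraph

variable {V : Type*} {G : SimpleGraph V}

/-- The vertex sequence `l` of a (nonempty) path of `G`. -/
structure IsPathList (G : SimpleGraph V) (l : List V) : Prop where
  ne_nil : l ≠ []
  isChain : l.IsChain G.Adj
  nodup : l.Nodup

namespace IsPathList

variable {l : List V}

theorem take (h : G.IsPathList l) {n : ℕ} (hn : 0 < n) : G.IsPathList (l.take n) where
  ne_nil := by simpa [h.ne_nil] using hn.ne'
  isChain := h.isChain.take n
  nodup := h.nodup.sublist (l.take_sublist n)

theorem drop (h : G.IsPathList l) {n : ℕ} (hn : n < l.length) : G.IsPathList (l.drop n) where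
  ne_nil := by simpa using hn
  isChain := h.isChain.drop n
  nodup := h.nodup.sublist (l.drop_sublist n)

theorem reverse (h : G.IsPathList l) : G.IsPathList l.reverse where
  ne_nil := by simpa using h.ne_nil
  isChain := List.isChain_reverse.2 (h.isChain.imp fun _ _ hab => hab.symm)
  nodup := List.nodup_reverse.2 h.nodup

theorem cons (h : G.IsPathList l) {w : V} (hw : w ∉ l) (hadj : G.Adj w (l.head h.ne_nil)) :
    G.IsPathList (w :: l) where
  ne_nil := by simp
  isChain := h.isChain.cons fun y hy => by
    rw [List.head?_eq_some_head h.ne_nil] at hy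
    simp_all
  nodup := List.nodup_cons.2 ⟨hw, h.nodup⟩

/-- A path whose ends are adjacent can be opened up at any of its vertices, and hence be extended
by any outside vertex with a neighbour on it. -/
theorem exists_longer_of_adj_ends (h : G.IsPathList l)
    (hends : G.Adj (l.getLast h.ne_nil) (l.head h.ne_nil))
    {v w : V} (hv : v ∈ l) (hw : w ∉ l) (hadj : G.Adj w v) :
    ∃ l', G.IsPathList l' ∧ l'.length = l.length + 1 := by
  obtain ⟨s, t, rfl⟩ := List.append_of_mem hv
  refine ⟨w :: ((v :: t) ++ s), cons (l := (v :: t) ++ s) ⟨by simp, ?_, ?_⟩ ?_ (by simpa), ?_⟩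
  · have hc := List.isChain_append.1 h.isChain
    refine hc.2.1.append hc.1 fun x hx y hy => ?_
    obtain ⟨hs, rfl⟩ : ∃ hs : s ≠ [], s.head hs = y := by
      cases s <;> simp_all
    rw [List.getLast?_eq_some_getLast (by simp)] at hx
    simp_all
  · exact (List.perm_append_comm.nodup_iff).1 h.nodup
  · exact fun hmem => hw (List.perm_append_comm.mem_iff.1 hmem)
  · simp; omega

end IsPathList

/-- If a set of vertices `S` is nonempty, some path inside `S` is longest. -/
theorem exists_longest_isPathList [Fintype V] (G : SimpleGraph V) (S : Set V) (hS : S.Nonempty) :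
    ∃ l, G.IsPathList l ∧ (∀ v ∈ l, v ∈ S) ∧
      ∀ l', G.IsPathList l' → (∀ v ∈ l', v ∈ S) → l'.length ≤ l.length := by
  classical
  let P : ℕ → Prop := fun n => ∃ l, G.IsPathList l ∧ (∀ v ∈ l, v ∈ S) ∧ l.length = n
  have hbound : ∀ l, G.IsPathList l → l.length ≤ Fintype.card V := fun l h =>
    h.nodup.length_le_card
  obtain ⟨v, hv⟩ := hS
  have h₁ : P 1 := ⟨[v], ⟨by simp, by simp, by simp⟩, by simpa using hv, rfl⟩
  have hcard : 1 ≤ Fintype.card V := Fintype.card_pos_iff.2 ⟨v⟩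
  obtain ⟨l, hl, hlS, hlen⟩ := Nat.findGreatest_spec (P := P) hcard h₁
  exact ⟨l, hl, hlS, fun l' hl' hlS' =>
    hlen ▸ Nat.le_findGreatest (hbound l' hl') ⟨l', hl', hlS', rfl⟩⟩

/-- In a set closed under adjacency, the neighbours of the first vertex of a longest path lie on
the path. -/
theorem IsPathList.mem_of_adj_head {l : List V} (h : G.IsPathList l) {S : Set V}
    (hS : ∀ v ∈ S, ∀ w, G.Adj v w → w ∈ S) (hlS : ∀ v ∈ l, v ∈ S)
    (hmax : ∀ l', G.IsPathList l' → (∀ v ∈ l', v ∈ S) → l'.length ≤ l.length)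
    {w : V} (hw : G.Adj (l.head h.ne_nil) w) : w ∈ l := by
  by_contra hwl
  have := hmax _ (h.cons hwl hw.symm) (by
    simpa using ⟨hS _ (hlS _ (List.head_mem _)) _ hw, hlS⟩)
  simp at this

variable [Fintype V] [DecidableRel G.Adj]

theorem IsPathList.minDegree_lt_length {l : List V} (h : G.IsPathList l)
    (hnbr : ∀ w, G.Adj (l.head h.ne_nil) w → w ∈ l) : G.minDegree < l.length := by
  classical
  have hsub : insert (l.head h.ne_nil) (G.neighborFinset (l.head h.ne_nil)) ⊆ l.toFinset := by
    intro w hw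
    rcases Finset.mem_insert.1 hw with rfl | hw
    · simp
    · simpa using hnbr w (by simpa using hw)
  have hcard := Finset.card_le_card hsub
  rw [Finset.card_insert_of_notMem (by simp), card_neighborFinset_eq_degree,
    List.toFinset_card_of_nodup h.nodup] at hcard
  have := G.minDegree_le_degree (l.head h.ne_nil)
  omega

/-- If both ends of a path on at most `2 δ(G)` vertices have all their neighbours on it,
then its vertices can be rearranged into a path with adjacent ends. -/
theorem IsPathList.exists_perm_adj_ends {l : List V} (h : G.IsPathList l)
    (hhead : ∀ w, G.Adj (l.head h.ne_nil) w → w ∈ l)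
    (hlast : ∀ w, G.Adj (l.getLast h.ne_nil) w → w ∈ l)
    (hlen : l.length ≤ 2 * G.minDegree) :
    ∃ (c : List V) (hc : G.IsPathList c), c.Perm l ∧
      G.Adj (c.getLast hc.ne_nil) (c.head hc.ne_nil) := by
  classical
  have hpos : 0 < l.length := List.length_pos_iff.2 h.ne_nil
  set a := l.head h.ne_nil with ha
  set b := l.getLast h.ne_nil with hb
  have ha0 : l[0] = a := by simp [ha, List.head_eq_getElem]
  have hbl : l[l.length - 1] = b := by simp [hb, List.getLast_eq_getElem]
  let A := (G.neighborFinset a).image fun w => l.idxOf w - 1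
  let B := (G.neighborFinset b).image fun w => l.idxOf w
  have hidx : ∀ w, G.Adj a w → 0 < l.idxOf w := fun w hw => by
    rw [Nat.pos_iff_ne_zero]
    intro h0
    exact hw.ne ((List.idxOf_eq_zero_iff_head_eq h.ne_nil).1 h0)
  have hA : A.card = G.degree a := by
    rw [← card_neighborFinset_eq_degree]
    refine Finset.card_image_of_injOn fun x hx y hy hxy => ?_
    have hx' : G.Adj a x := by simpa using hx
    have hy' : G.Adj a y := by simpa using hy
    have := hidx x hx'
    have := hidx y hy'
    exact (List.idxOf_inj (hhead x hx')).1 (by omega)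
  have hB : B.card = G.degree b := by
    rw [← card_neighborFinset_eq_degree]
    refine Finset.card_image_of_injOn fun x hx y hy hxy => ?_
    have hx' : G.Adj b x := by simpa using hx
    exact (List.idxOf_inj (hlast x hx')).1 hxy
  have hAB : A ∪ B ⊆ Finset.range (l.length - 1) := by
    intro i hi
    rw [Finset.mem_range]
    rcases Finset.mem_union.1 hi with hi | hi
    · obtain ⟨w, hw, rfl⟩ := Finset.mem_image.1 hi
      have hw' : G.Adj a w := by simpa using hw
      have := hidx w hw'
      have := List.idxOf_lt_length_iff.2 (hhead w hw')
      omega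
    · obtain ⟨w, hw, rfl⟩ := Finset.mem_image.1 hi
      have hw' : G.Adj b w := by simpa using hw
      have hlt := List.idxOf_lt_length_iff.2 (hlast w hw')
      have hne : l.idxOf w ≠ l.length - 1 := fun heq => hw'.ne (by
        rw [← hbl, ← List.getElem_idxOf hlt]
        simp only [heq])
      omega
  obtain ⟨i, hi⟩ : (A ∩ B).Nonempty := by
    rw [← Finset.card_pos]
    have h₁ := Finset.card_union_add_card_inter A B
    have h₂ := Finset.card_le_card hAB
    have h₃ := G.minDegree_le_degree a
    have h₄ := G.minDegree_le_degree b
    rw [Finset.card_range] at h₂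
    omega
  rw [Finset.mem_inter] at hi
  have hilt : i + 1 < l.length := by
    have := Finset.mem_range.1 (hAB (Finset.mem_union_left _ hi.1))
    omega
  have hadjA : G.Adj a l[i + 1] := by
    obtain ⟨w, hw, hwi⟩ := Finset.mem_image.1 hi.1
    have hw' : G.Adj a w := by simpa using hw
    have := hidx w hw'
    have heq : l.idxOf w = i + 1 := by omega
    have hlt := List.idxOf_lt_length_iff.2 (hhead w hw')
    have := List.getElem_idxOf hlt
    simp only [heq] at this
    rwa [this]
  have hadjB : G.Adj b l[i] := by
    obtain ⟨w, hw, hwi⟩ := Finset.mem_image.1 hi.2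
    have hw' : G.Adj b w := by simpa using hw
    have hlt := List.idxOf_lt_length_iff.2 (hlast w hw')
    have := List.getElem_idxOf hlt
    simp only [hwi] at this
    rwa [this]
  have hperm : ((l.take (i + 1)).reverse ++ l.drop (i + 1)).Perm l := by
    conv_rhs => rw [← List.take_append_drop (i + 1) l]
    exact (List.reverse_perm _).append_right _
  refine ⟨(l.take (i + 1)).reverse ++ l.drop (i + 1), ⟨?_, ?_, ?_⟩, hperm, ?_⟩
  · simp only [ne_eq, List.append_eq_nil_iff, List.drop_eq_nil_iff, not_and]
    omega
  · refine (h.take i.succ_pos).reverse.isChain.append (h.isChain.drop _) fun x hx y hy => ?_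
    have hx' : a = x := by
      simpa [List.head?_take, List.head?_eq_some_head h.ne_nil] using hx
    have hy' : l[i + 1] = y := by simpa [hilt] using hy
    rwa [← hx', ← hy']
  · exact hperm.nodup_iff.2 h.nodup
  · rw [List.getLast_append_of_ne_nil _ (by simpa using hilt), List.getLast_drop,
      List.head_append_of_ne_nil (by simp [h.ne_nil])]
    simpa [List.getLast_take, List.getElem?_eq_getElem (show i < l.length by omega)] using hadjB

/-- A graph on more than `2 δ(G)` vertices, `δ(G) > 0`, has disjoint paths on
`δ(G) + 1` and `δ(G)` vertices. -/
theorem exists_disjoint_isPathList (hpos : 0 < G.minDegree)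
    (hcard : 2 * G.minDegree < Fintype.card V) :
    ∃ l₁ l₂, G.IsPathList l₁ ∧ G.IsPathList l₂ ∧ l₁.length = G.minDegree + 1 ∧
      l₂.length = G.minDegree ∧ l₁.Disjoint l₂ := by
  have hV : Nonempty V := Fintype.card_pos_iff.1 (by omega)
  obtain ⟨l, hl, -, hmax⟩ := G.exists_longest_isPathList Set.univ Set.univ_nonempty
  have hhead : ∀ w, G.Adj (l.head hl.ne_nil) w → w ∈ l := fun w hw =>
    hl.mem_of_adj_head (S := Set.univ) (by simp) (by simp) hmax hw
  have hlast : ∀ w, G.Adj (l.getLast hl.ne_nil) w → w ∈ l := fun w hw => by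
    simpa using hl.reverse.mem_of_adj_head (S := Set.univ) (w := w) (by simp) (by simp)
      (by simpa using hmax) (by simpa using hw)
  have hlt := hl.minDegree_lt_length hhead
  rcases lt_or_ge (2 * G.minDegree) l.length with hlong | hshort
  · refine ⟨l.take (G.minDegree + 1), (l.drop (G.minDegree + 1)).take G.minDegree,
      hl.take (by omega), (hl.drop (by omega)).take hpos, by simp; omega, by simp; omega, ?_⟩
    exact fun v hv hv' => List.disjoint_take_drop hl.nodup le_rfl hv (List.mem_of_mem_take hv')
  obtain ⟨c, hc, hperm, hends⟩ := hl.exists_perm_adj_ends hhead hlast hshort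
  have hclosed : ∀ v ∈ {v | v ∉ l}, ∀ w, G.Adj v w → w ∈ {v | v ∉ l} := by
    intro v hv w hvw hw
    obtain ⟨l', hl', hlen⟩ := hc.exists_longer_of_adj_ends hends (hperm.mem_iff.2 hw)
      (fun hvc => hv (hperm.mem_iff.1 hvc)) hvw
    have := hmax l' hl' (by simp)
    rw [hperm.length_eq] at hlen
    omega
  have hout : {v | v ∉ l}.Nonempty := by
    classical
    obtain ⟨v, hv⟩ : ∃ v, v ∉ l.toFinset := by
      by_contra! hall
      have := Finset.card_le_card (fun v _ => hall v : Finset.univ ⊆ l.toFinset)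
      have := l.toFinset_card_le
      rw [Finset.card_univ] at *
      omega
    exact ⟨v, by simpa using hv⟩
  obtain ⟨m, hm, hml, hmmax⟩ := G.exists_longest_isPathList _ hout
  have hmlt := hm.minDegree_lt_length fun w hw => hm.mem_of_adj_head hclosed hml hmmax hw
  refine ⟨l.take (G.minDegree + 1), m.take G.minDegree, hl.take (by omega), hm.take hpos,
    by simp; omega, by simp; omega, fun v hv hv' => ?_⟩
  exact hml v (List.mem_of_mem_take hv') (List.mem_of_mem_take hv)

end SimpleGraph

theorem two_disjoint_paths
    {V : Type*} [Fintype V] (G : SimpleGraph V) [DecidableRel G.Adj]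
    (hδ2 : 2 ≤ G.minDegree)
    (hδ : (G.minDegree : ℚ) ≤ ((Fintype.card V : ℚ) - 1) / 2) :
    ∃ (a b c d : V) (p₁ : G.Walk a b) (p₂ : G.Walk c d),
      p₁.IsPath ∧ p₂.IsPath ∧
      p₁.support.length = G.minDegree + 1 ∧
      p₂.support.length = G.minDegree ∧
      ∀ v : V, v ∈ p₁.support → v ∉ p₂.support := by
  have hcard : 2 * G.minDegree < Fintype.card V := by
    have : ((2 * G.minDegree + 1 : ℕ) : ℚ) ≤ (Fintype.card V : ℚ) := by
      push_cast
      linarith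
    exact_mod_cast this
  obtain ⟨l₁, l₂, h₁, h₂, hlen₁, hlen₂, hdisj⟩ :=
    G.exists_disjoint_isPathList (by omega) hcard
  refine ⟨_, _, _, _, .ofSupport l₁ h₁.ne_nil h₁.isChain, .ofSupport l₂ h₂.ne_nil h₂.isChain,
    ?_, ?_, ?_, ?_, ?_⟩
  · simpa [SimpleGraph.Walk.isPath_def] using h₁.nodup
  · simpa [SimpleGraph.Walk.isPath_def] using h₂.nodup
  · simpa using hlen₁
  · simpa using hlen₂
  · intro v hv hv'
    rw [SimpleGraph.Walk.support_ofSupport] at hv hv'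
    exact hdisj hv hv'
end

section
/- Let G be a finite simple graph with maximum degree Δ(G) < (|V(G)|-1)/2, and let k be an integer with k ≥ ⌈|V(G)|/4⌉. Then V(G) can be partitioned into k subsets whose sizes pairwise differ by at most one, such that each subset induces a linear forest in G. -/
namespace SimpleGraph

variable {V : Type*}

/-- A graph whose vertices can be injectively ranked by natural numbers so that adjacent vertices
have consecutive ranks is a linear forest. -/
theorem isLinearForest_of_injective_rank {G : SimpleGraph V} (φ : V → ℕ)
    (hφ : Function.Injective φ)
    (hadj : ∀ u v, G.Adj u v → φ u + 1 = φ v ∨ φ v + 1 = φ u) : G.IsLinearForest := by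
  classical
  refine ⟨fun v w hw ↦ ?_, fun v a b c ha hb hc ↦ ?_⟩
  · obtain ⟨m, hm, hmax⟩ := w.support.toFinset.exists_max_image φ ⟨v, by simp⟩
    rw [List.mem_toFinset] at hm
    have hr := hw.rotate hm
    have hle : ∀ x ∈ (w.rotate m hm).support, φ x ≤ φ m := fun x hx ↦
      hmax x (by simpa using (Walk.mem_support_rotate_iff w m hm).1 hx)
    have hsnd := hadj _ _ ((w.rotate m hm).adj_snd hr.not_nil)
    have hpen := hadj _ _ ((w.rotate m hm).adj_penultimate hr.not_nil)
    have hsnd_le : φ (w.rotate m hm).snd ≤ φ m := hle _ ((w.rotate m hm).getVert_mem_support 1)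
    have hpen_le : φ (w.rotate m hm).penultimate ≤ φ m :=
      hle _ ((w.rotate m hm).getVert_mem_support ((w.rotate m hm).length - 1))
    exact hr.snd_ne_penultimate (hφ (by omega))
  · have := hadj _ _ ha
    have := hadj _ _ hb
    have := hadj _ _ hc
    rw [← hφ.eq_iff, ← hφ.eq_iff (a := a) (b := c), ← hφ.eq_iff (a := b)]
    omega

/-- At most four vertices, listed so that consecutive ones are not adjacent, induce a linear
forest: the complement of a path on four vertices is again a path. -/
theorem isLinearForest_of_four_positions {G : SimpleGraph V} (t : V → ℕ)
    (ht : Function.Injective t) (hlt : ∀ v, t v < 4)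
    (hadj : ∀ u v, t u + 1 = t v → ¬ G.Adj u v) : G.IsLinearForest := by
  -- The positions `2, 0, 3, 1` get the ranks `0, 1, 2, 3`.
  refine isLinearForest_of_injective_rank (fun v ↦ (2 * t v + 1) % 5) (fun u v h ↦ ht ?_)
    fun u v h ↦ ?_
  · have := hlt u
    have := hlt v
    dsimp only at h
    omega
  · have := hlt u
    have := hlt v
    have h₁ : t u + 1 ≠ t v := fun e ↦ hadj u v e h
    have h₂ : t v + 1 ≠ t u := fun e ↦ hadj v u e h.symm
    have h₃ : t u ≠ t v := ht.ne h.ne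
    clear hadj
    generalize t u = a at *
    generalize t v = b at *
    interval_cases a <;> interval_cases b <;> omega

end SimpleGraph

/-- Pigeonhole for consecutive entries of a list. -/
theorem List.exists_consecutive_of_length_le_countP {α : Type*} (p q : α → Bool) :
    ∀ l : List α, l ≠ [] → l.length ≤ l.tail.countP p + l.dropLast.countP q →
      ∃ A a b B, l = A ++ a :: b :: B ∧ p b ∧ q a
  | [], h, _ => absurd rfl h
  | [x], _, h => by simp at h
  | x :: y :: t, _, h => by
    by_cases hxy : p y ∧ q x
    · exact ⟨[], x, y, t, rfl, hxy⟩
    · obtain ⟨A, a, b, B, hl, hab⟩ :=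
        exists_consecutive_of_length_le_countP p q (y :: t) (by simp) (by
          simp only [List.tail_cons, List.dropLast_cons_cons, List.countP_cons, List.length_cons] at h ⊢
          grind)
      exact ⟨x :: A, a, b, B, by rw [hl]; rfl, hab⟩

namespace SimpleGraph

variable {V : Type*} [Fintype V]

/-- If all neighbors of `x` lie in a list, then it has at least `degree x` entries adjacent to
`x`. -/
theorem degree_le_countP (H : SimpleGraph V) [DecidableRel H.Adj] (x : V) (l : List V)
    (hl : ∀ v, H.Adj x v → v ∈ l) : H.degree x ≤ l.countP (fun v ↦ H.Adj x v) := by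
  classical
  rw [List.countP_eq_length_filter, ← card_neighborFinset_eq_degree]
  refine le_trans (Finset.card_le_card fun v hv ↦ ?_) (List.toFinset_card_le _)
  rw [mem_neighborFinset] at hv
  simp [hv, hl v hv]

/-- **Dirac's theorem** for paths: a graph on `n` vertices with minimum degree at least `n / 2`
has a Hamiltonian path, given here as a list of its vertices. -/
theorem exists_isChain_of_card_le_two_mul_degree (H : SimpleGraph V) [DecidableRel H.Adj]
    (hdeg : ∀ v, Fintype.card V ≤ 2 * H.degree v) :
    ∃ l : List V, l.Nodup ∧ (∀ v, v ∈ l) ∧ l.IsChain H.Adj := by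
  classical
  obtain ⟨l, ⟨hnd, hch⟩, hmax⟩ : ∃ l : List V, (l.Nodup ∧ l.IsChain H.Adj) ∧
      ∀ l' : List V, l'.Nodup → l'.IsChain H.Adj → l'.length ≤ l.length := by
    let S : Set ℕ := {n | ∃ l : List V, (l.Nodup ∧ l.IsChain H.Adj) ∧ l.length = n}
    have hS : BddAbove S := ⟨Fintype.card V, by
      rintro _ ⟨l, ⟨h, -⟩, rfl⟩
      exact h.length_le_card⟩
    obtain ⟨l, hl, hlen⟩ := Nat.sSup_mem (s := S) ⟨0, [], by simp⟩ hS
    exact ⟨l, hl, fun l' h h' ↦ hlen ▸ le_csSup hS ⟨l', ⟨h, h'⟩, rfl⟩⟩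
  refine ⟨l, hnd, fun w ↦ by_contra fun hw ↦ ?_, hch⟩
  have hne : l ≠ [] := by
    rintro rfl
    simpa using hmax [w] (by simp) (by simp)
  have hhead : ∀ v, H.Adj (l.head hne) v → v ∈ l.tail := by
    intro v hv
    by_contra hvt
    have hvl : v ∉ l := by
      rw [← List.cons_head_tail hne, List.mem_cons, not_or]
      exact ⟨hv.ne', hvt⟩
    have := hmax (v :: l) (List.nodup_cons.2 ⟨hvl, hnd⟩)
      (List.isChain_cons.2 ⟨by simp [List.head?_eq_some_head hne, hv.symm], hch⟩)
    simp at this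
  have hlast : ∀ v, H.Adj (l.getLast hne) v → v ∈ l.dropLast := by
    intro v hv
    by_contra hvt
    have hvl : v ∉ l := by
      rw [← List.dropLast_append_getLast hne, List.mem_append, not_or]
      exact ⟨hvt, by simpa using hv.ne'⟩
    have := hmax (l ++ [v]) (by simp [List.nodup_append, hnd]; grind)
      (List.isChain_append.2 ⟨hch, by simp, by simp [List.getLast?_eq_some_getLast hne, hv]⟩)
    simp at this
  have h₁ := H.degree_le_countP _ _ hhead
  have h₂ := H.degree_le_countP _ _ hlast
  have hlen : l.length ≤ Fintype.card V := hnd.length_le_card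
  obtain ⟨A, a, b, B, hl, hb, ha⟩ := List.exists_consecutive_of_length_le_countP
    (fun v ↦ decide (H.Adj (l.head hne) v)) (fun v ↦ decide (H.Adj (l.getLast hne) v)) l hne (by
      have := hdeg (l.head hne)
      have := hdeg (l.getLast hne)
      omega)
  simp only [decide_eq_true_eq] at ha hb
  -- Reversing the part after `a` gives a path whose two ends are adjacent.
  obtain ⟨c, hcperm, hcch, hcycle⟩ : ∃ c : List V, c.Perm l ∧ c.IsChain H.Adj ∧
      ∀ x ∈ c.getLast?, ∀ y ∈ c.head?, H.Adj x y := by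
    refine ⟨(A ++ [a]) ++ (b :: B).reverse, ?_, ?_, ?_⟩
    · rw [hl, show A ++ a :: b :: B = (A ++ [a]) ++ b :: B by simp]
      exact (List.reverse_perm _).append_left _
    · have hch' : ((A ++ [a]) ++ b :: B).IsChain H.Adj := by simpa [hl] using hch
      rw [List.isChain_append] at hch' ⊢
      refine ⟨hch'.1, ?_, ?_⟩
      · rw [List.isChain_reverse]
        exact hch'.2.1.imp fun _ _ h ↦ h.symm
      · intro x hx y hy
        have hx' : x = a := by simpa [eq_comm] using hx
        have hy' : y = l.getLast hne := by
          simp only [hl, List.head?_reverse] at hy ⊢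
          grind
        rw [hx', hy']
        exact ha.symm
    · intro x hx y hy
      have hx' : x = b := by
        rw [List.reverse_cons, ← List.append_assoc, List.getLast?_concat] at hx
        exact (Option.some.inj hx).symm
      have hy' : y = l.head hne := by
        simp only [hl] at hy ⊢
        cases A <;> exact (Option.some.inj hy).symm
      rw [hx', hy']
      exact hb.symm
  obtain ⟨v, hwv, hvl⟩ : ∃ v, H.Adj w v ∧ v ∈ l := by
    by_contra! hno
    have hdisj : Disjoint (H.neighborFinset w) (insert w l.toFinset) := by
      rw [Finset.disjoint_left]
      intro v hv
      rw [mem_neighborFinset] at hv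
      simpa using ⟨hv.ne', hno v hv⟩
    have hcard := Finset.card_le_univ (H.neighborFinset w ∪ insert w l.toFinset)
    rw [Finset.card_union_of_disjoint hdisj, Finset.card_insert_of_notMem (by simpa using hw),
      List.toFinset_card_of_nodup hnd, card_neighborFinset_eq_degree] at hcard
    have := hdeg w
    have := hdeg (l.head hne)
    have := List.countP_le_length (p := fun v ↦ decide (H.Adj (l.head hne) v)) (l := l.tail)
    have := List.length_pos_of_ne_nil hne
    rw [List.length_tail] at *
    omega
  obtain ⟨C, D, hc⟩ := List.append_of_mem (hcperm.mem_iff.2 hvl)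
  have hperm : (w :: ((v :: D) ++ C)).Perm (w :: l) :=
    (List.perm_append_comm.trans (hc ▸ hcperm)).cons w
  have hlong := hmax (w :: ((v :: D) ++ C))
    (hperm.nodup_iff.2 (List.nodup_cons.2 ⟨hw, hnd⟩)) (by
      rw [hc, List.isChain_append] at hcch
      rw [List.isChain_cons, List.isChain_append]
      refine ⟨by simpa using hwv, hcch.2.1, hcch.1, fun x hx y hy ↦ hcycle x ?_ y ?_⟩
      · rw [hc]
        rw [List.getLast?_append_of_ne_nil _ (by simp)]
        exact hx
      · rw [hc]
        rw [List.head?_append, Option.mem_def.1 hy]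
        rfl)
  rw [hperm.length_eq] at hlong
  simp at hlong

end SimpleGraph

/-- The cut points `i * n / k` split `0, …, n - 1` into `k` intervals. -/
theorem Nat.existsUnique_mul_div_le_lt {n k j : ℕ} (hk : 0 < k) (hj : j < n) :
    ∃! i : Fin k, i * n / k ≤ j ∧ j < (i + 1) * n / k := by
  have hmono : ∀ {a b : ℕ}, a ≤ b → a * n / k ≤ b * n / k := fun h ↦
    Nat.div_le_div_right (Nat.mul_le_mul_right n h)
  refine existsUnique_of_exists_of_unique ?_ ?_
  · have hex : ∃ m, j < m * n / k := ⟨k, by rwa [Nat.mul_div_cancel_left n hk]⟩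
    have hpos : Nat.find hex ≠ 0 := fun h ↦ by simpa [h] using Nat.find_spec hex
    obtain ⟨i, hi⟩ := Nat.exists_eq_succ_of_ne_zero hpos
    have hik : Nat.find hex ≤ k := Nat.find_le (by rwa [Nat.mul_div_cancel_left n hk])
    refine ⟨⟨i, by omega⟩, not_lt.1 (Nat.find_min hex (hi ▸ Nat.lt_succ_self i)), ?_⟩
    have := Nat.find_spec hex
    rwa [hi] at this
  · rintro a b ⟨ha, ha'⟩ ⟨hb, hb'⟩
    ext
    by_contra hab
    rcases lt_or_gt_of_ne hab with h | h
    · exact absurd (ha'.trans_le ((hmono h).trans hb)) (lt_irrefl _)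
    · exact absurd (hb'.trans_le ((hmono h).trans ha)) (lt_irrefl _)

theorem equitable_partition_small_maxDegree
    {V : Type*} [Fintype V] (G : SimpleGraph V) [DecidableRel G.Adj]
    (hΔ : (G.maxDegree : ℚ) < ((Fintype.card V : ℚ) - 1) / 2)
    (k : ℕ) (hk : (⌈(Fintype.card V : ℚ) / 4⌉ : ℤ) ≤ (k : ℤ)) :
    ∃ P : Fin k → Finset V,
      (∀ v : V, ∃! i : Fin k, v ∈ P i) ∧
      (∀ i j : Fin k, (P i).card ≤ (P j).card + 1) ∧
      (∀ i : Fin k, (G.induce (↑(P i) : Set V)).IsLinearForest) := by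
  classical
  have hn : 2 * G.maxDegree + 1 < Fintype.card V := by
    have : (2 * G.maxDegree + 1 : ℚ) < Fintype.card V := by linarith
    exact_mod_cast this
  have hnk : Fintype.card V ≤ 4 * k := by
    have h := Int.ceil_le.1 hk
    have : (Fintype.card V : ℚ) ≤ 4 * k := by
      push_cast at h
      linarith
    exact_mod_cast this
  have hk0 : 0 < k := by omega
  obtain ⟨l, hnd, hmem, hch⟩ := Gᶜ.exists_isChain_of_card_le_two_mul_degree fun v ↦ by
    have := G.degree_le_maxDegree v
    rw [SimpleGraph.degree_compl]
    omega
  let e : Fin l.length ≃ V := hnd.getEquivOfForallMemList l hmem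
  have hlen : l.length = Fintype.card V := by simpa using Fintype.card_congr e
  have hcons : ∀ i j : Fin l.length, (i : ℕ) + 1 = j → ¬ G.Adj (e i) (e j) := by
    rintro ⟨i, hi⟩ ⟨j, hj⟩ rfl
    have := List.isChain_iff_getElem.1 hch i hj
    rw [SimpleGraph.compl_adj] at this
    exact this.2
  rw [← hlen] at hnk
  clear_value e
  generalize l.length = n at *
  let s : ℕ → ℕ := fun i ↦ i * n / k
  have hs_lower : ∀ i, s i + n / k ≤ s (i + 1) := fun i ↦ by
    simp only [s, Nat.succ_mul]
    exact Nat.div_add_div_le_add_div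
  have hs_upper : ∀ i, s (i + 1) ≤ s i + n / k + 1 := fun i ↦ by
    simp only [s, Nat.succ_mul, Nat.add_div hk0]
    split_ifs <;> omega
  have hs_four : ∀ i, s (i + 1) ≤ s i + 4 := fun i ↦ by
    simp only [s, Nat.succ_mul]
    rw [← Nat.add_mul_div_right _ _ hk0]
    exact Nat.div_le_div_right (by omega)
  have hs_le : ∀ i : Fin k, s (i + 1) ≤ n := fun i ↦
    Nat.div_le_of_le_mul (Nat.mul_le_mul_right n i.2)
  let P : Fin k → Finset V := fun i ↦
    {v | s i ≤ e.symm v ∧ (e.symm v : ℕ) < s (i + 1)}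
  have hPmem : ∀ i v, v ∈ P i ↔ s i ≤ e.symm v ∧ (e.symm v : ℕ) < s (i + 1) := by simp [P]
  have hPcard : ∀ i, (P i).card = s (i + 1) - s i := fun i ↦ by
    rw [← Nat.card_Ico]
    refine Finset.card_bij (fun v _ ↦ (e.symm v : ℕ)) (fun v hv ↦ by simpa [hPmem] using hv)
      (fun u _ v _ h ↦ e.symm.injective (Fin.ext h)) fun j hj ↦ ?_
    rw [Finset.mem_Ico] at hj
    exact ⟨e ⟨j, hj.2.trans_le (hs_le i)⟩, by simpa [hPmem] using hj, by simp⟩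
  refine ⟨P, fun v ↦ ?_, fun i j ↦ ?_, fun i ↦ ?_⟩
  · simpa only [hPmem] using Nat.existsUnique_mul_div_le_lt hk0 (e.symm v).2
  · have := hs_upper i
    have := hs_lower j
    rw [hPcard, hPcard]
    omega
  · have hP : ∀ v : (↑(P i) : Set V), s i ≤ e.symm v ∧ (e.symm v : ℕ) < s (i + 1) := fun v ↦
      (hPmem i v).1 v.2
    have := hs_four i
    refine SimpleGraph.isLinearForest_of_four_positions (fun v ↦ (e.symm v : ℕ) - s i)
      (fun u v h ↦ Subtype.ext (e.symm.injective (Fin.ext ?_))) (fun v ↦ ?_) fun u v h ↦ ?_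
    · have := hP u
      have := hP v
      dsimp only at h
      omega
    · have := hP v
      omega
    · have := hP u
      have := hP v
      simpa using hcons (e.symm u) (e.symm v) (by omega)
end

section
/- Let G be any finite simple graph and let k be an integer with k ≥ max{⌈(Δ(G)+1)/2⌉, ⌈|V(G)|/4⌉}. Then V(G) can be partitioned into k subsets whose sizes pairwise differ by at most one, such that each subset induces a linear forest in G. -/
namespace SimpleGraph

open List

variable {V : Type*} (H : SimpleGraph V)

open Classical in
/-- The adjacency indicator of a graph. -/
noncomputable def link (a b : V) : ℕ := if H.Adj a b then 1 else 0

/-- The number of consecutive entries of a list that are adjacent in the graph. -/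
noncomputable def links : List V → ℕ
  | [] => 0
  | [_] => 0
  | a :: b :: l => H.link a b + links (b :: l)

variable {H}

theorem link_comm (a b : V) : H.link a b = H.link b a := by
  unfold link; congr 1; exact propext (H.adj_comm a b)

theorem link_le_one (a b : V) : H.link a b ≤ 1 := by
  unfold link; split <;> simp

theorem link_eq_one {a b : V} : H.link a b = 1 ↔ H.Adj a b := by
  simp [link]

theorem link_eq_zero {a b : V} : H.link a b = 0 ↔ ¬ H.Adj a b := by
  simp [link]

@[simp] theorem links_nil : H.links [] = 0 := rfl

@[simp] theorem links_singleton (a : V) : H.links [a] = 0 := rfl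

@[simp] theorem links_cons_cons (a b : V) (l : List V) :
    H.links (a :: b :: l) = H.link a b + H.links (b :: l) := rfl

theorem links_append (x : List V) (a b : V) (y : List V) :
    H.links (x ++ a :: b :: y) = H.links (x ++ [a]) + H.link a b + H.links (b :: y) := by
  induction x with
  | nil => simp
  | cons c x ih =>
    cases x with
    | nil => simp; ring
    | cons d x => simp only [cons_append, links_cons_cons] at ih ⊢; rw [ih]; ring

theorem links_reverse (l : List V) : H.links l.reverse = H.links l := by
  induction l with
  | nil => rfl
  | cons a l ih =>
    cases l with
    | nil => rfl
    | cons b l =>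
      have := links_append (H := H) l.reverse b a []
      simp only [reverse_cons, append_assoc, cons_append, nil_append] at ih this ⊢
      rw [this, ih, links_cons_cons, links_singleton, link_comm b a]
      ring

theorem links_lt_length {l : List V} (hl : l ≠ []) : H.links l < l.length := by
  induction l with
  | nil => contradiction
  | cons a l ih =>
    cases l with
    | nil => simp
    | cons b l =>
      have := ih (by simp)
      have := link_le_one (H := H) a b
      simp only [links_cons_cons, length_cons] at *
      omega

theorem exists_gap_of_links_lt {l : List V} (hl : H.links l + 1 < l.length) :
    ∃ x a b y, l = x ++ a :: b :: y ∧ ¬ H.Adj a b := by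
  induction l with
  | nil => simp at hl
  | cons a l ih =>
    cases l with
    | nil => simp at hl
    | cons b l =>
      by_cases hab : H.Adj a b
      · have h1 := link_eq_one.2 hab
        obtain ⟨x, c, d, y, h, hcd⟩ := ih (by
          simp only [links_cons_cons, length_cons] at *; omega)
        exact ⟨a :: x, c, d, y, by simp [h], hcd⟩
      · exact ⟨[], a, b, l, rfl, hab⟩

variable (H) in
/-- A list that has the most links among all of its permutations. -/
def IsMaxLinked (l : List V) : Prop := ∀ l', l' ~ l → H.links l' ≤ H.links l

theorem exists_isMaxLinked (l : List V) : ∃ l', l' ~ l ∧ H.IsMaxLinked l' := by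
  classical
  obtain ⟨m, hm, hmax⟩ := l.permutations.toFinset.exists_max_image H.links
    ⟨l, by simp⟩
  simp only [mem_toFinset, mem_permutations] at hm hmax
  exact ⟨m, hm, fun l' h => hmax l' (h.trans hm)⟩

theorem IsMaxLinked.of_perm {l l' : List V} (hl : H.IsMaxLinked l) (hp : l' ~ l)
    (h : H.links l ≤ H.links l') : H.IsMaxLinked l' :=
  fun m hm => (hl m (hm.trans hp)).trans h

theorem exists_append_singleton_eq_cons {x y u : List V} {a h : V} (e : x ++ a :: y = h :: u) :
    ∃ u', x ++ [a] = h :: u' := by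
  cases x with
  | nil => exact ⟨[], by simp_all⟩
  | cons c x => exact ⟨x ++ [a], by simp_all⟩

theorem exists_cons_eq_append_singleton {x y v : List V} {b t : V} (e : x ++ b :: y = v ++ [t]) :
    ∃ v', b :: y = v' ++ [t] := by
  rcases eq_nil_or_concat (b :: y) with h | ⟨z, s, h⟩
  · simp at h
  · rw [concat_eq_append] at h
    rw [h, ← append_assoc] at e
    obtain rfl : s = t := by simpa using (append_inj' e rfl).2
    exact ⟨z, h⟩

theorem IsMaxLinked.not_adj_ends {l : List V} (hl : H.IsMaxLinked l)
    (hlt : H.links l + 1 < l.length) {h t : V} {u v : List V}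
    (hu : l = h :: u) (hv : l = v ++ [t]) : ¬ H.Adj t h := by
  obtain ⟨x, a, b, y, rfl, hab⟩ := exists_gap_of_links_lt hlt
  obtain ⟨x', hx⟩ := exists_append_singleton_eq_cons hu
  obtain ⟨y', hy⟩ := exists_cons_eq_append_singleton (x := x ++ [a]) (by simpa using hv)
  have key := hl (y' ++ t :: h :: x') (by
    have e1 : y' ++ t :: h :: x' = (b :: y) ++ (x ++ [a]) := by rw [hx, hy]; simp
    have e2 : x ++ a :: b :: y = (x ++ [a]) ++ (b :: y) := by simp
    rw [e1, e2]
    exact perm_append_comm)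
  rw [links_append, links_append, ← hx, ← hy, link_eq_zero.2 hab] at key
  rw [← link_eq_zero]
  omega

theorem IsMaxLinked.link_add_link_le {x y u v : List V} {a b h t : V}
    (hl : H.IsMaxLinked (x ++ a :: b :: y))
    (hlt : H.links (x ++ a :: b :: y) + 1 < (x ++ a :: b :: y).length)
    (hu : x ++ [a] = h :: u) (hv : b :: y = v ++ [t]) :
    H.link h b + H.link t a ≤ H.link a b := by
  have e : x ++ a :: b :: y = (x ++ [a]) ++ (b :: y) := by simp
  have e1 : u.reverse ++ h :: b :: y = (x ++ [a]).reverse ++ (b :: y) := by simp [hu]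
  have e2 : x ++ a :: t :: v.reverse = (x ++ [a]) ++ (b :: y).reverse := by simp [hv]
  have p1 : u.reverse ++ h :: b :: y ~ x ++ a :: b :: y := by
    rw [e1, e]; exact (reverse_perm _).append_right _
  have p2 : x ++ a :: t :: v.reverse ~ x ++ a :: b :: y := by
    rw [e2, e]; exact (reverse_perm _).append_left _
  have r1 : H.links (u.reverse ++ [h]) = H.links (x ++ [a]) := by
    rw [hu, ← links_reverse (h :: u)]; simp
  have r2 : H.links (t :: v.reverse) = H.links (b :: y) := by
    rw [hv, ← links_reverse (v ++ [t])]; simp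
  have k1 := hl _ p1
  have k2 := hl _ p2
  rw [links_append, links_append, r1] at k1
  rw [links_append, links_append, r2] at k2
  have hta := link_le_one (H := H) t a
  have hhb := link_le_one (H := H) h b
  have hab := link_le_one (H := H) a b
  rw [link_comm a t] at k2
  by_cases hb : H.link h b = 1
  · have hmax := hl.of_perm p1 (by rw [links_append, links_append, r1]; omega)
    have : ¬ H.Adj t a := by
      refine hmax.not_adj_ends (h := a) (t := t) (u := x.reverse ++ b :: y)
        (v := u.reverse ++ h :: v) ?_ ?_ (by simp [hv])
      · rw [p1.length_eq, links_append, r1]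
        rw [links_append] at hlt
        omega
      · rw [e1]; simp
    rw [← link_eq_zero] at this
    omega
  · omega

theorem sum_tail_add_sum_dropLast_le_links (f g : V → ℕ) (c : V) (l : List V)
    (h : ∀ x a b y, c :: l = x ++ a :: b :: y → f b + g a ≤ H.link a b) :
    (l.map f).sum + ((c :: l).dropLast.map g).sum ≤ H.links (c :: l) := by
  induction l generalizing c with
  | nil => simp
  | cons d l ih =>
    have h0 := h [] c d l rfl
    have h1 := ih d fun x a b y e => h (c :: x) a b y (by simp [e])
    simp only [map_cons, sum_cons, links_cons_cons, dropLast_cons_cons] at *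
    omega

theorem sum_map_link_eq_degree [Fintype V] [DecidableRel H.Adj] {l : List V}
    (hl : l ~ (Finset.univ : Finset V).toList) (v : V) : (l.map (H.link v)).sum = H.degree v := by
  rw [(hl.map _).sum_eq, Finset.sum_map_toList, ← H.card_neighborFinset_eq_degree,
    H.neighborFinset_eq_filter, Finset.card_filter]
  refine Finset.sum_congr rfl fun x _ => ?_
  unfold link
  congr

/-- The vertices of a graph of minimum degree at least `d` can be listed so that the list
splits into at most `max 1 (n - 2 * d)` paths. -/
theorem exists_list_links_ge [Fintype V] [DecidableRel H.Adj] {d : ℕ} (hd : ∀ v, d ≤ H.degree v) :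
    ∃ l, l ~ (Finset.univ : Finset V).toList ∧
      (Fintype.card V ≤ H.links l + 1 ∨ 2 * d ≤ H.links l) := by
  obtain ⟨l, hp, hmax⟩ := exists_isMaxLinked (H := H) (Finset.univ : Finset V).toList
  refine ⟨l, hp, ?_⟩
  have hlen : l.length = Fintype.card V := by rw [hp.length_eq]; simp
  by_contra! hcon
  obtain ⟨hlt, hdeg⟩ := hcon
  rw [← hlen] at hlt
  obtain ⟨h, u, rfl⟩ : ∃ h u, l = h :: u := exists_cons_of_length_pos (by omega)
  obtain ⟨v, t, hv⟩ : ∃ v t, h :: u = v ++ [t] := by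
    rcases eq_nil_or_concat (h :: u) with h0 | ⟨v, t, h0⟩
    · simp at h0
    · exact ⟨v, t, by simpa using h0⟩
  have key := sum_tail_add_sum_dropLast_le_links (H := H) (H.link h) (H.link t) h u (by
    intro x a b y e
    obtain ⟨u', hu'⟩ := exists_append_singleton_eq_cons e.symm
    obtain ⟨v', hv'⟩ := exists_cons_eq_append_singleton (x := x ++ [a]) (y := y) (b := b)
      (by rw [← hv, e]; simp)
    rw [e] at hmax hlt
    exact hmax.link_add_link_le hlt hu' hv')
  have s1 := sum_map_link_eq_degree (H := H) hp h
  have s2 := sum_map_link_eq_degree (H := H) hp t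
  have hh : H.link h h = 0 := link_eq_zero.2 (H.loopless.irrefl h)
  have ht : H.link t t = 0 := link_eq_zero.2 (H.loopless.irrefl t)
  have d1 := hd h
  have d2 := hd t
  rw [hv] at s2
  rw [show (h :: u).dropLast = v by rw [hv]; simp] at key
  simp only [map_cons, sum_cons, map_append, sum_append, map_nil, sum_nil] at s1 s2
  omega

/-- A graph whose vertices can be placed at distinct integers so that adjacent vertices are
consecutive is a linear forest. -/
theorem isLinearForest_of_injective {G : SimpleGraph V} (f : V → ℕ) (hf : Function.Injective f)
    (h : ∀ a b, G.Adj a b → f a = f b + 1 ∨ f b = f a + 1) : G.IsLinearForest := by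
  classical
  refine ⟨fun v w hw => ?_, fun v a b c ha hb hc => ?_⟩
  · obtain ⟨z, hz, hmax⟩ := w.support.toFinset.exists_max_image f ⟨v, by simp⟩
    simp only [mem_toFinset] at hz hmax
    have hc := hw.rotate hz
    have hmem : ∀ x, x ∈ (w.rotate z hz).support → f x ≤ f z := fun x hx =>
      hmax x ((Walk.mem_support_rotate_iff w z hz).1 hx)
    have h1 := h _ _ (Walk.adj_snd hc.not_nil)
    have h2 := h _ _ (Walk.adj_penultimate hc.not_nil)
    have h3 := hmem _ (Walk.getVert_mem_support _ 1)
    have h4 := hmem _ (Walk.getVert_mem_support _ ((w.rotate z hz).length - 1))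
    apply hc.snd_ne_penultimate
    apply hf
    unfold Walk.snd Walk.penultimate at *
    omega
  · have := h _ _ ha
    have := h _ _ hb
    have := h _ _ hc
    simp only [← hf.eq_iff]
    omega

/-- A set induces a linear forest if it is contained in a list of vertices in which only consecutive
entries are adjacent. -/
theorem induce_isLinearForest_of_list {G : SimpleGraph V} {s : Set V} (l : List V)
    (hs : ∀ v ∈ s, v ∈ l)
    (h : ∀ i j (hi : i < l.length) (hj : j < l.length), i + 1 < j → ¬ G.Adj l[i] l[j]) :
    (G.induce s).IsLinearForest := by
  classical
  have hlt : ∀ v : s, l.idxOf v.1 < l.length := fun v => idxOf_lt_length_of_mem (hs v v.2)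
  have hget : ∀ v : s, l[l.idxOf v.1]'(hlt v) = v.1 := fun v => getElem_idxOf (hlt v)
  have hinj : Function.Injective fun v : s => l.idxOf v.1 := by
    intro a b hab
    simp only at hab
    apply Subtype.ext
    rw [← hget a, ← hget b]
    simp only [hab]
  refine isLinearForest_of_injective _ hinj fun a b hab => ?_
  have hne : l.idxOf a.1 ≠ l.idxOf b.1 := fun e => hab.ne (hinj e)
  have hadj : G.Adj a.1 b.1 := hab
  have h1 := h _ _ (hlt a) (hlt b)
  have h2 := h _ _ (hlt b) (hlt a)
  rw [hget, hget] at h1 h2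
  by_contra hcon
  rcases lt_or_gt_of_ne hne with h' | h'
  · exact h1 (by omega) hadj
  · exact h2 (by omega) hadj.symm

variable (H) in
/-- A list of at most four vertices that induces a linear forest in the complement of `H`,
for one of the reasons that can be read off from paths of `H`. -/
inductive IsBlock : ℕ → List V → Prop
  | nil : IsBlock 0 []
  | one (a : V) : IsBlock 1 [a]
  | two (a b : V) : IsBlock 2 [a, b]
  | three {a b : V} (c : V) (hab : H.Adj a b) : IsBlock 3 [a, b, c]
  | four {a b c d : V} (hab : H.Adj a b) (hbc : H.Adj b c) (hcd : H.Adj c d) :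
      IsBlock 4 [a, b, c, d]

theorem IsBlock.length_eq {n : ℕ} {l : List V} (h : H.IsBlock n l) : l.length = n := by
  cases h <;> rfl

theorem IsBlock.isLinearForest {G : SimpleGraph V} {n : ℕ} {l : List V} (h : Gᶜ.IsBlock n l) :
    (G.induce {v | v ∈ l}).IsLinearForest := by
  cases h with
  | nil => exact induce_isLinearForest_of_list [] (by simp) (by simp)
  | one a => exact induce_isLinearForest_of_list [a] (by simp) (by simp)
  | two a b =>
    exact induce_isLinearForest_of_list [a, b] (by simp) (by simp; omega)
  | @three a b c hab =>
    refine induce_isLinearForest_of_list [a, c, b] (by simp) ?_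
    intro i j hi hj hij
    simp only [length_cons, length_nil] at hi hj
    obtain ⟨rfl, rfl⟩ : i = 0 ∧ j = 2 := by omega
    exact ((G.compl_adj a b).1 hab).2
  | @four a b c d hab hbc hcd =>
    refine induce_isLinearForest_of_list [c, a, d, b] (by simp) ?_
    intro i j hi hj hij
    simp only [length_cons, length_nil] at hi hj
    obtain ⟨rfl, rfl⟩ | ⟨rfl, rfl⟩ | ⟨rfl, rfl⟩ :
      i = 0 ∧ j = 2 ∨ i = 0 ∧ j = 3 ∨ i = 1 ∧ j = 3 := by omega
    · exact ((G.compl_adj c d).1 hcd).2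
    · exact ((G.compl_adj c b).1 hbc.symm).2
    · exact ((G.compl_adj a b).1 hab).2

/-- The list `l` can be cut up, after reordering, into `n` lists with the property `P`. -/
def Packs (P : List V → Prop) (n : ℕ) (l : List V) : Prop :=
  ∃ B : List (List V), B.length = n ∧ (∀ w ∈ B, P w) ∧ B.flatten ~ l

section Packs

variable {P Q : List V → Prop} {l l' : List V} {n n' : ℕ}

theorem Packs.zero : Packs P 0 ([] : List V) := ⟨[], by simp⟩

theorem Packs.eq_nil (h : Packs P 0 l) : l = [] := by
  obtain ⟨B, hB, -, hp⟩ := h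
  obtain rfl := length_eq_zero_iff.1 hB
  simpa using hp

theorem Packs.single (h : P l) : Packs P 1 l := ⟨[l], by simpa⟩

theorem Packs.perm (h : Packs P n l) (hp : l ~ l') : Packs P n l' := by
  obtain ⟨B, h1, h2, h3⟩ := h
  exact ⟨B, h1, h2, h3.trans hp⟩

theorem Packs.mono (h : Packs P n l) (hPQ : ∀ w, P w → Q w) : Packs Q n l := by
  obtain ⟨B, h1, h2, h3⟩ := h
  exact ⟨B, h1, fun w hw => hPQ w (h2 w hw), h3⟩

theorem Packs.append (h : Packs P n l) (h' : Packs P n' l') : Packs P (n + n') (l ++ l') := by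
  obtain ⟨B, rfl, h2, h3⟩ := h
  obtain ⟨B', rfl, h2', h3'⟩ := h'
  refine ⟨B ++ B', by simp, fun w hw => ?_, by simpa using h3.append h3'⟩
  exact (mem_append.1 hw).elim (h2 w) (h2' w)

theorem Packs.exists_of_succ (h : Packs P (n + 1) l) : ∃ w r, P w ∧ Packs P n r ∧ l ~ w ++ r := by
  obtain ⟨B, h1, h2, h3⟩ := h
  obtain ⟨w, B, rfl⟩ := exists_cons_of_length_eq_add_one h1
  exact ⟨w, B.flatten, h2 w (by simp), ⟨B, by simpa using h1, fun u hu => h2 u (by simp [hu]),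
    .rfl⟩,
    by simpa using h3.symm⟩

theorem Packs.length_eq {s : ℕ} (h : Packs P n l) (hP : ∀ w, P w → w.length = s) :
    l.length = n * s := by
  induction n generalizing l with
  | zero => simp [h.eq_nil]
  | succ n ih =>
    obtain ⟨w, r, hw, hr, hp⟩ := h.exists_of_succ
    rw [hp.length_eq, length_append, hP w hw, ih hr]
    ring

end Packs

theorem packs_nil_block (n : ℕ) : Packs (H.IsBlock 0) n [] := by
  induction n with
  | zero => exact .zero
  | succ n ih => simpa using ih.append (.single IsBlock.nil)

theorem packs_one_block (l : List V) : Packs (H.IsBlock 1) l.length l := by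
  induction l with
  | nil => exact .zero
  | cons a l ih =>
    simpa [add_comm] using (Packs.single (IsBlock.one (H := H) a)).append ih

theorem packs_two_block {n : ℕ} {l : List V} (hl : l.length = 2 * n) :
    Packs (H.IsBlock 2) n l := by
  induction n generalizing l with
  | zero => rw [length_eq_zero_iff.1 hl]; exact .zero
  | succ n ih =>
    obtain ⟨a, b, l, rfl⟩ : ∃ a b r, l = a :: b :: r := by
      match l, hl with
      | a :: b :: r, _ => exact ⟨a, b, r, rfl⟩
    simpa [add_comm] using (Packs.single (IsBlock.two (H := H) a b)).append
      (ih (l := l) (by simp only [length_cons] at hl; omega))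

variable (H) in
/-- A list consisting of the two ends of an edge. -/
def IsEdgeList (w : List V) : Prop := ∃ a b, w = [a, b] ∧ H.Adj a b

theorem Packs.three_block {n : ℕ} {l z : List V} (h : Packs H.IsEdgeList n l)
    (hz : z.length = n) : Packs (H.IsBlock 3) n (l ++ z) := by
  induction n generalizing l z with
  | zero => rw [h.eq_nil, length_eq_zero_iff.1 hz]; exact .zero
  | succ n ih =>
    obtain ⟨w, r, ⟨a, b, rfl, hab⟩, hr, hp⟩ := h.exists_of_succ
    obtain ⟨c, z, rfl⟩ := exists_cons_of_length_eq_add_one hz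
    have := (Packs.single (IsBlock.three c hab)).append (ih hr (z := z) (by simpa using hz))
    rw [add_comm] at this
    refine this.perm ?_
    refine .trans ?_ (hp.symm.append_right _)
    simpa using (perm_middle (a := c) (l₁ := r) (l₂ := z)).symm

variable (H) in
/-- The list `l` can be cut up, after reordering, into `p` paths on four vertices, `q` edges
and `r` single vertices. -/
def Splits (p q r : ℕ) (l : List V) : Prop :=
  ∃ x y z, Packs (H.IsBlock 4) p x ∧ Packs H.IsEdgeList q y ∧ z.length = r ∧ l ~ x ++ y ++ z

section Splits

variable {l l' : List V} {p q r p' q' r' : ℕ}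

theorem Splits.length_eq (h : H.Splits p q r l) : l.length = 4 * p + 2 * q + r := by
  obtain ⟨x, y, z, hx, hy, hz, hp⟩ := h
  have h1 := hx.length_eq fun w hw => hw.length_eq
  have h2 := hy.length_eq (s := 2) (by rintro _ ⟨a, b, rfl, -⟩; rfl)
  rw [hp.length_eq, length_append, length_append]
  omega

theorem Splits.append (h : H.Splits p q r l) (h' : H.Splits p' q' r' l') :
    H.Splits (p + p') (q + q') (r + r') (l ++ l') := by
  obtain ⟨x, y, z, hx, hy, hz, hp⟩ := h
  obtain ⟨x', y', z', hx', hy', hz', hp'⟩ := h'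
  refine ⟨x ++ x', y ++ y', z ++ z', hx.append hx', hy.append hy', by simp [hz, hz'],
    (hp.append hp').trans ?_⟩
  rw [← Multiset.coe_eq_coe]
  simp only [← Multiset.coe_add]
  abel

theorem splits_path {a b c d : V} (hab : H.Adj a b) (hbc : H.Adj b c) (hcd : H.Adj c d) :
    H.Splits 1 0 0 [a, b, c, d] :=
  ⟨_, [], [], .single (.four hab hbc hcd), .zero, rfl, by simp⟩

theorem splits_edge {a b : V} (hab : H.Adj a b) : H.Splits 0 1 0 [a, b] :=
  ⟨[], _, [], .zero, .single ⟨a, b, rfl, hab⟩, rfl, by simp⟩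

theorem splits_vertices (l : List V) : H.Splits 0 0 l.length l :=
  ⟨[], [], l, .zero, .zero, rfl, by simp⟩

theorem Splits.split_path (h : H.Splits (p + 1) q r l) : H.Splits p (q + 2) r l := by
  obtain ⟨x, y, z, hx, hy, hz, hl⟩ := h
  obtain ⟨w, x', hw, hx', hxp⟩ := hx.exists_of_succ
  cases hw with
  | @four a b c d hab hbc hcd =>
    refine ⟨x', y ++ ([a, b] ++ [c, d]), z, hx', hy.append ((Packs.single ⟨a, b, rfl, hab⟩).append
      (Packs.single ⟨c, d, rfl, hcd⟩)), hz, hl.trans ?_⟩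
    refine ((hxp.append_right y).append_right z).trans ?_
    rw [← Multiset.coe_eq_coe]
    change (([a, b] ++ [c, d] ++ x' ++ y ++ z : List V) : Multiset V) = _
    simp only [← Multiset.coe_add]
    abel

theorem Splits.split_edge (h : H.Splits p (q + 1) r l) : H.Splits p q (r + 2) l := by
  obtain ⟨x, y, z, hx, hy, hz, hl⟩ := h
  obtain ⟨w, y', ⟨a, b, rfl, hab⟩, hy', hyp⟩ := hy.exists_of_succ
  refine ⟨x, y', z ++ [a, b], hx, hy', by simp [hz], hl.trans ?_⟩
  refine ((hyp.append_left x).append_right z).trans ?_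
  rw [← Multiset.coe_eq_coe]
  simp only [← Multiset.coe_add]
  abel

theorem Splits.split_paths (h : H.Splits p q r l) {s : ℕ} (hs : s ≤ p) :
    H.Splits s (q + 2 * (p - s)) r l := by
  obtain ⟨t, rfl⟩ := Nat.exists_eq_add_of_le hs
  induction t generalizing q with
  | zero => simpa using h
  | succ t ih =>
    convert ih (Splits.split_path h) (by omega) using 1
    omega

theorem Splits.split_edges (h : H.Splits p q r l) {s : ℕ} (hs : s ≤ q) :
    H.Splits p s (r + 2 * (q - s)) l := by
  obtain ⟨t, rfl⟩ := Nat.exists_eq_add_of_le hs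
  induction t generalizing r with
  | zero => simpa using h
  | succ t ih =>
    convert ih (Splits.split_edge h) (by omega) using 1
    omega

/-- Cutting each of the at most `m` maximal paths of a list into paths on four vertices leaves
at most one edge and at most one vertex per path. -/
theorem exists_splits (m : ℕ) (l : List V) (hl : l.length ≤ H.links l + m) :
    ∃ p q r, q ≤ m ∧ r ≤ m ∧ H.Splits p q r l := by
  have drop : ∀ {q₀ r₀ : ℕ} {u s : List V}, u ++ s = l → u ≠ [] → q₀ ≤ 1 → r₀ ≤ 1 →
      H.Splits 0 q₀ r₀ u → H.links l + 1 ≤ u.length + H.links s →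
      ∃ p q r, q ≤ m ∧ r ≤ m ∧ H.Splits p q r l := by
    intro q₀ r₀ u s e hu hq hr hsp hlk
    have hlen : u.length + s.length = l.length := by rw [← e]; simp
    have : 1 ≤ m := by
      have := links_lt_length (H := H) (l := l) (by rw [← e]; simp [hu])
      omega
    have hpos := length_pos_iff.2 hu
    obtain ⟨p, q, r, h1, h2, h3⟩ := exists_splits (m - 1) s (by omega)
    refine ⟨0 + p, q₀ + q, r₀ + r, by omega, by omega, ?_⟩
    rw [← e]
    exact hsp.append h3
  have edge_vertex : ∀ {a b c : V}, H.Adj a b → H.Splits 0 1 1 [a, b, c] := fun hab =>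
    (splits_edge hab).append (splits_vertices [_])
  match l with
  | [] => exact ⟨0, 0, 0, by simp, by simp, splits_vertices []⟩
  | [a] =>
    exact drop (u := [a]) (s := []) rfl (by simp) zero_le_one le_rfl
      (splits_vertices [a]) (by simp)
  | [a, b] =>
    by_cases hab : H.Adj a b
    · exact drop (u := [a, b]) (s := []) rfl (by simp) le_rfl zero_le_one (splits_edge hab)
        (by simp [link_le_one])
    · exact drop (u := [a]) (s := [b]) rfl (by simp) zero_le_one le_rfl (splits_vertices [a])
        (by simp [link_eq_zero.2 hab])
  | [a, b, c] =>
    by_cases hab : H.Adj a b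
    · refine drop (u := [a, b, c]) (s := []) rfl (by simp) le_rfl le_rfl (edge_vertex hab) ?_
      have := link_le_one (H := H) a b
      have := link_le_one (H := H) b c
      simp; omega
    · exact drop (u := [a]) (s := [b, c]) rfl (by simp) zero_le_one le_rfl (splits_vertices [a])
        (by simp [link_eq_zero.2 hab])
  | a :: b :: c :: d :: s =>
    have l1 := link_le_one (H := H) a b
    have l2 := link_le_one (H := H) b c
    have l3 := link_le_one (H := H) c d
    by_cases hab : H.Adj a b
    swap
    · exact drop (u := [a]) (s := b :: c :: d :: s) rfl (by simp) zero_le_one le_rfl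
        (splits_vertices [a]) (by simp [link_eq_zero.2 hab])
    by_cases hbc : H.Adj b c
    swap
    · exact drop (u := [a, b]) (s := c :: d :: s) rfl (by simp) le_rfl zero_le_one
        (splits_edge hab) (by simp [link_eq_zero.2 hbc]; omega)
    by_cases hcd : H.Adj c d
    swap
    · exact drop (u := [a, b, c]) (s := d :: s) rfl (by simp) le_rfl le_rfl
        (edge_vertex hab) (by simp [link_eq_zero.2 hcd]; omega)
    have hds : H.links (d :: s) ≤ H.links s + 1 := by
      cases s with
      | nil => simp
      | cons e s => have := link_le_one (H := H) d e; simp; omega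
    obtain ⟨p, q, r, h1, h2, h3⟩ := exists_splits m s (by
      simp only [links_cons_cons, length_cons] at hl; omega)
    refine ⟨1 + p, 0 + q, 0 + r, by omega, by omega, (splits_path hab hbc hcd).append h3⟩
termination_by l.length

end Splits

/-- A graph on `n ≤ 4 * k` vertices with minimum degree at least `n - 2 * k` has its vertices cut
up into `k` blocks of almost equal sizes. -/
theorem exists_packs_block [Fintype V] [DecidableRel H.Adj] {k : ℕ}
    (hn : Fintype.card V ≤ 4 * k) (hd : ∀ v, Fintype.card V - 2 * k ≤ H.degree v) :
    ∃ s, Packs (fun w => H.IsBlock s w ∨ H.IsBlock (s + 1) w) k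
      (Finset.univ : Finset V).toList := by
  obtain ⟨l, hl, hlinks⟩ := exists_list_links_ge hd
  have hlen : l.length = Fintype.card V := by rw [hl.length_eq]; simp
  suffices ∃ s i j x y, i + j = k ∧ Packs (H.IsBlock s) i x ∧ Packs (H.IsBlock (s + 1)) j y ∧
      x ++ y ~ l by
    obtain ⟨s, i, j, x, y, rfl, hx, hy, hp⟩ := this
    exact ⟨s, ((hx.mono fun _ => .inl).append (hy.mono fun _ => .inr)).perm (hp.trans hl)⟩
  rw [← hlen] at hn hlinks
  rcases le_or_gt l.length k with h1 | h1
  · exact ⟨0, k - l.length, l.length, [], l, by omega, packs_nil_block _, packs_one_block l, .rfl⟩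
  rcases le_or_gt l.length (2 * k) with h2 | h2
  · refine ⟨1, 2 * k - l.length, l.length - k, l.take (2 * k - l.length),
      l.drop (2 * k - l.length), by omega, ?_, packs_two_block ?_, by simp⟩
    · convert packs_one_block (H := H) (l.take (2 * k - l.length)) using 1
      simp; omega
    · simp; omega
  obtain ⟨p, q, r, hq, hr, hs⟩ := exists_splits (H := H) (l.length - H.links l) l
    (by omega)
  have hlen' := hs.length_eq
  rcases le_or_gt l.length (3 * k) with h3 | h3
  · have hs' := (hs.split_paths (Nat.zero_le p)).split_edges (s := l.length - 2 * k) (by omega)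
    obtain ⟨x, y, z, hx, hy, hz, hp⟩ := hs'
    obtain rfl := hx.eq_nil
    have hz' : z.length = 4 * k - l.length := by omega
    refine ⟨2, 3 * k - l.length, l.length - 2 * k, z.drop (l.length - 2 * k),
      y ++ z.take (l.length - 2 * k), by omega, packs_two_block ?_,
      hy.three_block ?_, ?_⟩
    · simp; omega
    · simp; omega
    refine .trans ?_ hp.symm
    refine perm_append_comm.trans ?_
    simp
  · have hs' := (hs.split_paths (s := l.length - 3 * k) (by omega)).split_edges
      (s := 4 * k - l.length) (by omega)
    obtain ⟨x, y, z, hx, hy, hz, hp⟩ := hs'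
    refine ⟨3, 4 * k - l.length, l.length - 3 * k, y ++ z, x, by omega,
      hy.three_block (z := z) (by omega), hx, ?_⟩
    refine perm_append_comm.trans ?_
    rw [← append_assoc]
    exact hp.symm

end SimpleGraph

theorem equitable_partition_general
    {V : Type*} [Fintype V] (G : SimpleGraph V) [DecidableRel G.Adj]
    (k : ℕ)
    (hk : max (⌈((G.maxDegree : ℚ) + 1) / 2⌉ : ℤ) (⌈(Fintype.card V : ℚ) / 4⌉ : ℤ) ≤ (k : ℤ)) :
    ∃ P : Fin k → Finset V,
      (∀ v : V, ∃! i : Fin k, v ∈ P i) ∧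
      (∀ i j : Fin k, (P i).card ≤ (P j).card + 1) ∧
      (∀ i : Fin k, (G.induce (↑(P i) : Set V)).IsLinearForest) := by
  classical
  obtain ⟨h1, h2⟩ := max_le_iff.1 hk
  rw [Int.ceil_le, div_le_iff₀ (by norm_num)] at h1 h2
  have hdeg : G.maxDegree + 1 ≤ 2 * k := by
    have : G.maxDegree + 1 ≤ k * 2 := by exact_mod_cast h1
    omega
  have hcard : Fintype.card V ≤ 4 * k := by
    have : Fintype.card V ≤ k * 4 := by exact_mod_cast h2
    omega
  obtain ⟨s, B, rfl, hB, hp⟩ := SimpleGraph.exists_packs_block (H := Gᶜ) hcard (by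
    intro v
    rw [SimpleGraph.degree_compl]
    have := G.degree_le_maxDegree v
    omega)
  have hnodup : B.flatten.Nodup := hp.nodup_iff.2 (Finset.nodup_toList _)
  obtain ⟨hn, hdisj⟩ := List.nodup_flatten.1 hnodup
  have hsize : ∀ i : Fin B.length, B[i].toFinset.card = s ∨ B[i].toFinset.card = s + 1 := by
    intro i
    have hi : B[i] ∈ B := List.getElem_mem i.2
    rw [List.toFinset_card_of_nodup (hn _ hi)]
    exact (hB _ hi).imp (·.length_eq) (·.length_eq)
  refine ⟨fun i => B[i].toFinset, fun v => ?_, fun i j => ?_, fun i => ?_⟩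
  · have hv : v ∈ B.flatten := hp.mem_iff.2 (by simp)
    obtain ⟨w, hw, hvw⟩ := List.mem_flatten.1 hv
    obtain ⟨i, hi, rfl⟩ := List.mem_iff_getElem.1 hw
    refine ⟨⟨i, hi⟩, by simpa using hvw, fun j hj => ?_⟩
    have hvj : v ∈ B[(j : ℕ)] := by simpa using hj
    rw [List.pairwise_iff_getElem] at hdisj
    apply Fin.ext
    by_contra hne
    rcases lt_or_gt_of_ne hne with h | h
    · exact hdisj _ _ j.2 hi h hvj hvw
    · exact hdisj _ _ hi j.2 h hvw hvj
  · have := hsize i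
    have := hsize j
    dsimp only
    omega
  · have hset : (↑(B[i].toFinset) : Set V) = {v | v ∈ B[i]} := by ext; simp
    rw [hset]
    exact (hB _ (List.getElem_mem i.2)).elim (·.isLinearForest) (·.isLinearForest)
end

section
/- Let G be a finite simple graph with maximum degree Δ(G) ≥ (|V(G)|-1)/2, and let k be an integer with ⌈(Δ(G)+1)/2⌉ ≤ k and |V(G)|/3 ≤ k < |V(G)|/2. Then V(G) can be partitioned into k subsets, each of size 2 or 3, such that each subset induces a linear forest in G. -/
namespace SimpleGraph

variable {V : Type*}

/-- Every vertex on a cycle has two distinct neighbours on that cycle. -/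
theorem Walk.IsCycle.exists_two_neighbors {G : SimpleGraph V} {u : V} {c : G.Walk u u}
    (hc : c.IsCycle) {v : V} (hv : v ∈ c.support) :
    ∃ p ∈ c.support, ∃ q ∈ c.support, p ≠ q ∧ G.Adj v p ∧ G.Adj v q := by
  classical
  have hr := hc.rotate hv
  refine ⟨(c.rotate v hv).snd, ?_, (c.rotate v hv).penultimate, ?_, hr.snd_ne_penultimate,
    (c.rotate v hv).adj_snd hr.not_nil, ((c.rotate v hv).adj_penultimate hr.not_nil).symm⟩
  · rw [← c.mem_support_rotate_iff v hv]
    exact Walk.getVert_mem_support _ _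
  · rw [← c.mem_support_rotate_iff v hv]
    exact Walk.getVert_mem_support _ _

/-- A graph all of whose vertices lie among `x`, `y`, `z`, with `x` and `y` not adjacent, is a
linear forest. -/
theorem isLinearForest_of_three {G : SimpleGraph V} (x y z : V) (hxy : ¬ G.Adj x y)
    (h : ∀ v, v = x ∨ v = y ∨ v = z) : G.IsLinearForest := by
  constructor
  · intro u c hc
    obtain ⟨p, hp, q, -, hpq, hup, huq⟩ := hc.exists_two_neighbors c.start_mem_support
    obtain ⟨p₁, -, p₂, -, hp₁₂, hpp₁, hpp₂⟩ := hc.exists_two_neighbors hp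
    have := G.ne_of_adj hup
    have := G.ne_of_adj huq
    have := G.ne_of_adj hpp₁
    have := G.ne_of_adj hpp₂
    have hadj : G.Adj p q := by
      grind only [h u, h p, h q, h p₁, h p₂]
    have := hup.symm
    have := huq.symm
    have := hadj.symm
    grind only [h u, h p, h q]
  · intro v a b c ha hb hc
    have := G.ne_of_adj ha
    have := G.ne_of_adj hb
    have := G.ne_of_adj hc
    grind only [h v, h a, h b, h c]

theorem induce_isLinearForest_of_three [DecidableEq V] {G : SimpleGraph V} (x y z : V)
    (hxy : ¬ G.Adj x y) :
    (G.induce (↑({x, y, z} : Finset V) : Set V)).IsLinearForest := by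
  refine isLinearForest_of_three ⟨x, by simp⟩ ⟨y, by simp⟩ ⟨z, by simp⟩ (by simpa using hxy) ?_
  rintro ⟨v, hv⟩
  simpa using hv

theorem induce_isLinearForest_of_two [DecidableEq V] {G : SimpleGraph V} (x y : V) :
    (G.induce (↑({x, y} : Finset V) : Set V)).IsLinearForest := by
  have h := induce_isLinearForest_of_three (G := G) x x y (G.loopless.irrefl x)
  rwa [Finset.insert_idem] at h

/-- `a` and `b` list the endpoints of `m` pairwise disjoint edges of `H`. -/
structure IsMatchingList (H : SimpleGraph V) {m : ℕ} (a b : Fin m → V) : Prop where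
  injective_left : Function.Injective a
  injective_right : Function.Injective b
  ne : ∀ i j, a i ≠ b j
  adj : ∀ i, H.Adj (a i) (b i)

namespace IsMatchingList

variable {H : SimpleGraph V} {m : ℕ} {a b : Fin m → V}

theorem cons (h : H.IsMatchingList a b) {u w : V} (hu : ∀ i, u ≠ a i ∧ u ≠ b i)
    (hw : ∀ i, w ≠ a i ∧ w ≠ b i) (huw : H.Adj u w) :
    H.IsMatchingList (Fin.cons u a : Fin (m + 1) → V) (Fin.cons w b : Fin (m + 1) → V) := by
  refine ⟨?_, ?_, ?_, ?_⟩
  · refine Fin.cons_injective_iff.2 ⟨?_, h.injective_left⟩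
    rintro ⟨i, hi⟩
    exact (hu i).1 hi.symm
  · refine Fin.cons_injective_iff.2 ⟨?_, h.injective_right⟩
    rintro ⟨i, hi⟩
    exact (hw i).2 hi.symm
  · intro i j
    refine Fin.cases ?_ (fun i => ?_) i <;> refine Fin.cases ?_ (fun j => ?_) j
    · simpa using huw.ne
    · simpa using (hu j).2
    · simpa using (hw i).1.symm
    · simpa using h.ne i j
  · intro i
    refine Fin.cases ?_ (fun i => ?_) i
    · simpa using huw
    · simpa using h.adj i

theorem update (h : H.IsMatchingList a b) {u : V} (hu : ∀ i, u ≠ a i ∧ u ≠ b i) (i : Fin m)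
    (hui : H.Adj u (a i)) : H.IsMatchingList a (Function.update b i u) := by
  obtain ⟨h₁, h₂, h₃, h₄⟩ := h
  refine ⟨h₁, ?_, ?_, ?_⟩
  · intro j l hjl
    have := @h₂ j l
    grind [Function.update_apply]
  · intro j l
    grind [Function.update_apply]
  · intro j
    have := hui.symm
    grind [Function.update_apply]

/-- Replacing the edge `a i – b i` by the two edges `a i – u` and `w – b i`. -/
theorem augment (h : H.IsMatchingList a b) {u w : V} (huw : u ≠ w)
    (hu : ∀ i, u ≠ a i ∧ u ≠ b i) (hw : ∀ i, w ≠ a i ∧ w ≠ b i) (i : Fin m)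
    (hui : H.Adj u (a i)) (hwi : H.Adj w (b i)) :
    ∃ a' b' : Fin (m + 1) → V, H.IsMatchingList a' b' := by
  refine ⟨_, _, (h.update hu i hui).cons (u := w) (w := b i) ?_ ?_ hwi⟩
  · intro j
    grind [Function.update_apply]
  · intro j
    have := h.ne j i
    have := h.injective_right.eq_iff (a := i) (b := j)
    grind [Function.update_apply]

theorem degree_le [Fintype V] [DecidableRel H.Adj] (a b : Fin m → V) (u : V)
    (hu : ∀ v, H.Adj u v → ∃ i, v = a i ∨ v = b i) :
    H.degree u ≤ ∑ i, ((if H.Adj u (a i) then 1 else 0) + (if H.Adj u (b i) then 1 else 0)) := by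
  classical
  rw [Finset.sum_add_distrib, ← Finset.card_filter, ← Finset.card_filter]
  refine le_trans ?_ (Nat.add_le_add (Finset.card_image_le (f := a))
    (Finset.card_image_le (f := b)))
  refine le_trans (Finset.card_le_card ?_) (Finset.card_union_le _ _)
  intro v hv
  rw [mem_neighborFinset] at hv
  obtain ⟨i, rfl | rfl⟩ := hu v hv
  · exact Finset.mem_union_left _ (Finset.mem_image_of_mem _ (by simpa using hv))
  · exact Finset.mem_union_right _ (Finset.mem_image_of_mem _ (by simpa using hv))

theorem exists_succ [Fintype V] [DecidableRel H.Adj] {t : ℕ} (h : H.IsMatchingList a b)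
    (hdeg : ∀ v, t ≤ H.degree v) (hm : m < t) (hcard : 2 * t ≤ Fintype.card V) :
    ∃ a' b' : Fin (m + 1) → V, H.IsMatchingList a' b' := by
  classical
  by_cases hfree : ∃ u w, (∀ i, u ≠ a i ∧ u ≠ b i) ∧ (∀ i, w ≠ a i ∧ w ≠ b i) ∧ H.Adj u w
  · obtain ⟨u, w, hu, hw, huw⟩ := hfree
    exact ⟨_, _, h.cons hu hw huw⟩
  have hcov : ∀ u, (∀ i, u ≠ a i ∧ u ≠ b i) → ∀ v, H.Adj u v → ∃ i, v = a i ∨ v = b i := by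
    intro u hu v huv
    by_contra! hv
    exact hfree ⟨u, v, hu, hv, huv⟩
  let C : Finset V := Finset.univ.image a ∪ Finset.univ.image b
  have hC : C.card ≤ 2 * m := by
    refine (Finset.card_union_le _ _).trans ?_
    have h₁ : (Finset.univ.image a).card ≤ m := by
      simpa using Finset.card_image_le (s := Finset.univ) (f := a)
    have h₂ : (Finset.univ.image b).card ≤ m := by
      simpa using Finset.card_image_le (s := Finset.univ) (f := b)
    omega
  have hC' : 1 < Cᶜ.card := by
    rw [Finset.card_compl]
    omega
  obtain ⟨u, hu, w, hw, huw⟩ := Finset.one_lt_card.1 hC'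
  have hout : ∀ v ∈ Cᶜ, ∀ i, v ≠ a i ∧ v ≠ b i := by
    intro v hv i
    simp only [C, Finset.mem_compl, Finset.mem_union, Finset.mem_image, Finset.mem_univ,
      true_and, not_or, not_exists] at hv
    exact ⟨fun e => hv.1 i e.symm, fun e => hv.2 i e.symm⟩
  replace hu := hout u hu
  replace hw := hout w hw
  have hsum := Nat.add_le_add ((hdeg u).trans (degree_le a b u (hcov u hu)))
    ((hdeg w).trans (degree_le a b w (hcov w hw)))
  rw [← Finset.sum_add_distrib] at hsum
  obtain ⟨i, -, hi⟩ : ∃ i ∈ (Finset.univ : Finset (Fin m)),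
      2 < ((if H.Adj u (a i) then 1 else 0) + (if H.Adj u (b i) then 1 else 0)) +
        ((if H.Adj w (a i) then 1 else 0) + (if H.Adj w (b i) then 1 else 0)) := by
    refine Finset.exists_lt_of_sum_lt ?_
    refine lt_of_lt_of_le ?_ hsum
    simp only [Finset.sum_const, Finset.card_univ, Fintype.card_fin, smul_eq_mul]
    omega
  have hcases : (H.Adj u (a i) ∧ H.Adj w (b i)) ∨ (H.Adj w (a i) ∧ H.Adj u (b i)) := by
    by_contra hne
    split_ifs at hi <;> first | omega | tauto
  obtain ⟨h₁, h₂⟩ | ⟨h₁, h₂⟩ := hcases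
  · exact h.augment huw hu hw i h₁ h₂
  · exact h.augment huw.symm hw hu i h₁ h₂

end IsMatchingList

/-- A graph of minimum degree at least `t` on at least `2 * t` vertices has `t` disjoint edges. -/
theorem exists_isMatchingList [Fintype V] (H : SimpleGraph V) [DecidableRel H.Adj] {t : ℕ}
    (hdeg : ∀ v, t ≤ H.degree v) (hcard : 2 * t ≤ Fintype.card V) :
    ∃ a b : Fin t → V, H.IsMatchingList a b := by
  suffices ∀ m ≤ t, ∃ a b : Fin m → V, H.IsMatchingList a b from this t le_rfl
  intro m
  induction m with
  | zero =>
    exact fun _ => ⟨Fin.elim0, Fin.elim0, fun i => i.elim0, fun i => i.elim0, fun i => i.elim0,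
      fun i => i.elim0⟩
  | succ m ih =>
    intro hm
    obtain ⟨a, b, h⟩ := ih (by omega)
    exact h.exists_succ hdeg hm hcard

/-- `t` disjoint pairs of vertices can be completed to a listing of all vertices. -/
theorem IsMatchingList.exists_equiv [Fintype V] {H : SimpleGraph V} {t s : ℕ} {a b : Fin t → V}
    (h : H.IsMatchingList a b) (hcard : Fintype.card V = 3 * t + 2 * s) :
    ∃ e : (Fin t ⊕ Fin t) ⊕ (Fin t ⊕ (Fin s ⊕ Fin s)) ≃ V,
      (∀ i, e (.inl (.inl i)) = a i) ∧ ∀ i, e (.inl (.inr i)) = b i := by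
  classical
  have hinj : Function.Injective (Sum.elim a b) :=
    h.injective_left.sumElim h.injective_right h.ne
  have hrange : Fintype.card (Set.range (Sum.elim a b)) = t + t := by
    rw [← Fintype.card_congr (Equiv.ofInjective _ hinj)]
    simp
  have hcompl : Fintype.card (Fin t ⊕ (Fin s ⊕ Fin s)) =
      Fintype.card ((Set.range (Sum.elim a b))ᶜ : Set V) := by
    rw [Fintype.card_compl_set, hrange, hcard]
    simp
    omega
  refine ⟨(Equiv.sumCongr (Equiv.ofInjective _ hinj) (Fintype.equivOfCardEq hcompl)).trans
    (Equiv.Set.sumCompl _), fun i => ?_, fun i => ?_⟩ <;> simp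

end SimpleGraph

open SimpleGraph in
theorem partition_into_parts_of_size_two_or_three
    {V : Type*} [Fintype V] (G : SimpleGraph V) [DecidableRel G.Adj]
    (hΔ : ((Fintype.card V : ℚ) - 1) / 2 ≤ (G.maxDegree : ℚ))
    (k : ℕ)
    (hk1 : (⌈((G.maxDegree : ℚ) + 1) / 2⌉ : ℤ) ≤ (k : ℤ))
    (hk2 : (Fintype.card V : ℚ) / 3 ≤ (k : ℚ))
    (hk3 : (k : ℚ) < (Fintype.card V : ℚ) / 2) :
    ∃ P : Fin k → Finset V,
      (∀ v : V, ∃! i : Fin k, v ∈ P i) ∧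
      (∀ i : Fin k, (P i).card = 2 ∨ (P i).card = 3) ∧
      (∀ i : Fin k, (G.induce (↑(P i) : Set V)).IsLinearForest) := by
  classical
  have hk1' : G.maxDegree + 1 ≤ 2 * k := by
    rw [Int.ceil_le, div_le_iff₀ (by norm_num)] at hk1
    push_cast at hk1
    have : ((G.maxDegree + 1 : ℕ) : ℚ) ≤ ((2 * k : ℕ) : ℚ) := by push_cast; linarith
    exact_mod_cast this
  have hk2' : Fintype.card V ≤ 3 * k := by
    have : ((Fintype.card V : ℕ) : ℚ) ≤ ((3 * k : ℕ) : ℚ) := by push_cast; linarith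
    exact_mod_cast this
  have hk3' : 2 * k < Fintype.card V := by
    have : ((2 * k : ℕ) : ℚ) < ((Fintype.card V : ℕ) : ℚ) := by push_cast; linarith
    exact_mod_cast this
  obtain ⟨t, ht⟩ := Nat.exists_eq_add_of_lt hk3'
  obtain ⟨s, hs⟩ := Nat.exists_eq_add_of_le (show t + 1 ≤ k by omega)
  obtain ⟨a, b, hab⟩ := exists_isMatchingList Gᶜ (t := t + 1)
    (fun v => by
      rw [degree_compl]
      have := G.degree_le_maxDegree v
      omega) (by omega)
  obtain ⟨e, ha, hb⟩ := hab.exists_equiv (s := s) (by omega)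
  let σ : Fin k ≃ Fin (t + 1) ⊕ Fin s := (finCongr hs).trans finSumFinEquiv.symm
  let Q : Fin (t + 1) ⊕ Fin s → Finset V := Sum.elim
    (fun i => {e (.inl (.inl i)), e (.inl (.inr i)), e (.inr (.inl i))})
    (fun j => {e (.inr (.inr (.inl j))), e (.inr (.inr (.inr j)))})
  have hQ : ∀ v, ∃! i, v ∈ Q i := by
    intro v
    obtain ⟨x, rfl⟩ := e.surjective v
    obtain (i | i) | i | i | i := x
    · exact ⟨.inl i, by simp [Q], by rintro (j | j) <;> simp [Q, eq_comm]⟩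
    · exact ⟨.inl i, by simp [Q], by rintro (j | j) <;> simp [Q, eq_comm]⟩
    · exact ⟨.inl i, by simp [Q], by rintro (j | j) <;> simp [Q, eq_comm]⟩
    · exact ⟨.inr i, by simp [Q], by rintro (j | j) <;> simp [Q, eq_comm]⟩
    · exact ⟨.inr i, by simp [Q], by rintro (j | j) <;> simp [Q, eq_comm]⟩
  have hcard : ∀ i, (Q i).card = 2 ∨ (Q i).card = 3 := by
    rintro (i | i)
    · exact .inr (Finset.card_eq_three.2 ⟨e (.inl (.inl i)), e (.inl (.inr i)),
        e (.inr (.inl i)), by simp, by simp, by simp, rfl⟩)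
    · exact .inl (Finset.card_eq_two.2 ⟨e (.inr (.inr (.inl i))), e (.inr (.inr (.inr i))),
        by simp, rfl⟩)
  have hforest : ∀ i, (G.induce (↑(Q i) : Set V)).IsLinearForest := by
    rintro (i | i)
    · refine induce_isLinearForest_of_three _ _ _ ?_
      rw [ha, hb]
      exact ((compl_adj _ _ _).1 (hab.adj i)).2
    · exact induce_isLinearForest_of_two _ _
  refine ⟨fun i => Q (σ i), fun v => ?_, fun i => hcard (σ i), fun i => hforest (σ i)⟩
  obtain ⟨i, hi, huniq⟩ := hQ v
  exact ⟨σ.symm i, by simpa using hi, fun j hj => by simp [← huniq _ hj]⟩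
end

section
/- Let G be a finite simple graph with maximum degree Δ(G) ≥ (|V(G)|-1)/2, and let k be an integer with ⌈(Δ(G)+1)/2⌉ ≤ k < |V(G)|/3. Then V(G) can be partitioned into k subsets, each of size 3 or 4, such that each subset induces a linear forest in G. -/
namespace SimpleGraph

/-! ### Linear forests on three or four vertices -/

/-- A graph whose vertices can be numbered injectively so that adjacent vertices receive
consecutive numbers is a linear forest. -/
theorem IsLinearForest.of_numbering {V : Type*} {G : SimpleGraph V} (f : V → ℕ)
    (hf : Function.Injective f) (hadj : ∀ u v, G.Adj u v → f u + 1 = f v ∨ f v + 1 = f u) :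
    G.IsLinearForest := by
  classical
  refine ⟨fun v c hc => ?_, fun v a b c ha hb hc => ?_⟩
  · obtain ⟨w, hw, hmin⟩ := c.support.toFinset.exists_min_image f ⟨v, by simp⟩
    have hw' : w ∈ c.support := by simpa using hw
    obtain ⟨a, b, hab, hset⟩ := Set.ncard_eq_two.mp (hc.ncard_neighborSet_toSubgraph_eq_two hw')
    have above : ∀ x ∈ c.toSubgraph.neighborSet w, f x = f w + 1 := by
      intro x hx
      have hxw : c.toSubgraph.Adj w x := hx
      have hmem : x ∈ c.support := c.mem_verts_toSubgraph.mp hxw.snd_mem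
      have := hmin x (by simpa using hmem)
      have := hadj w x hxw.adj_sub
      lia
    exact hab (hf ((above a (by simp [hset])).trans (above b (by simp [hset])).symm))
  · have h1 := hadj v a ha
    have h2 := hadj v b hb
    have h3 := hadj v c hc
    simp only [← hf.eq_iff]
    lia

variable {V : Type*} {G : SimpleGraph V}

theorem isLinearForest_induce_of_compl_path [DecidableEq V] {x y z w : V}
    (hxy : Gᶜ.Adj x y) (hyz : Gᶜ.Adj y z) (hzw : Gᶜ.Adj z w) :
    (G.induce (({x, y, z, w} : Finset V) : Set V)).IsLinearForest := by
  rw [compl_adj] at hxy hyz hzw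
  have hxy' := fun h : G.Adj y x => hxy.2 h.symm
  have hyz' := fun h : G.Adj z y => hyz.2 h.symm
  have hzw' := fun h : G.Adj w z => hzw.2 h.symm
  refine .of_numbering
    (fun v => if v.1 = z then 0 else if v.1 = x then 1 else if v.1 = w then 2 else 3) ?_ ?_
  · rintro ⟨u, hu⟩ ⟨v, hv⟩ h
    simp at hu hv h ⊢
    grind
  · rintro ⟨u, hu⟩ ⟨v, hv⟩ h
    have hne := h.ne
    simp at hu hv h hne ⊢
    grind

theorem isLinearForest_induce_of_compl_edge [DecidableEq V] {x y r : V} (hxy : Gᶜ.Adj x y) :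
    (G.induce (({x, y, r} : Finset V) : Set V)).IsLinearForest := by
  rw [compl_adj] at hxy
  have hxy' := fun h : G.Adj y x => hxy.2 h.symm
  refine .of_numbering (fun v => if v.1 = x then 0 else if v.1 = r then 1 else 2) ?_ ?_
  · rintro ⟨u, hu⟩ ⟨v, hv⟩ h
    simp at hu hv h ⊢
    grind
  · rintro ⟨u, hu⟩ ⟨v, hv⟩ h
    have hne := h.ne
    simp at hu hv h hne ⊢
    grind

/-! ### Partitions of a vertex set into small linear forests -/

/-- The vertex set `T` has size three or four and induces a linear forest in `G`. -/
def IsSmallLinearForest (G : SimpleGraph V) (T : Finset V) : Prop :=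
  (T.card = 3 ∨ T.card = 4) ∧ (G.induce (T : Set V)).IsLinearForest

/-- The vertices of `S` can be coloured with `k` colours such that each colour class has size
three or four and induces a linear forest in `G`. -/
def HasSmallForestPartition (G : SimpleGraph V) (S : Finset V) (k : ℕ) : Prop :=
  ∃ f : V → ℕ, (∀ v ∈ S, f v < k) ∧ ∀ i < k, G.IsSmallLinearForest (S.filter fun v => f v = i)

theorem HasSmallForestPartition.empty : G.HasSmallForestPartition ∅ 0 :=
  ⟨fun _ => 0, by simp, by simp⟩

theorem IsSmallLinearForest.hasSmallForestPartition {T : Finset V}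
    (hT : G.IsSmallLinearForest T) : G.HasSmallForestPartition T 1 := by
  refine ⟨fun _ => 0, by simp, fun i hi => ?_⟩
  obtain rfl : i = 0 := by lia
  simpa using hT

theorem HasSmallForestPartition.union [DecidableEq V] {S T : Finset V} {k m : ℕ}
    (hST : Disjoint S T) (hS : G.HasSmallForestPartition S k) (hT : G.HasSmallForestPartition T m) :
    G.HasSmallForestPartition (S ∪ T) (k + m) := by
  obtain ⟨f, hfk, hf⟩ := hS
  obtain ⟨g, hgm, hg⟩ := hT
  rw [Finset.disjoint_left] at hST
  refine ⟨fun v => if v ∈ S then f v else k + g v, ?_, fun i hi => ?_⟩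
  · grind
  · by_cases hik : i < k
    · convert hf i hik using 1
      grind
    · convert hg (i - k) (by lia) using 1
      grind

/-- A path of the complement with `4 * a + 2 * b` vertices, together with `b` further vertices,
splits into `a` paths of the complement on four vertices and `b` triples containing an edge of
the complement. -/
theorem hasSmallForestPartition_of_isChain_compl [DecidableEq V] (a b : ℕ) (l R : List V)
    (hnd : (l ++ R).Nodup) (hl : l.IsChain Gᶜ.Adj) (hlen : l.length = 4 * a + 2 * b)
    (hR : R.length = b) : G.HasSmallForestPartition (l ++ R).toFinset (a + b) := by
  induction a generalizing l with
  | zero =>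
    induction b generalizing l R with
    | zero =>
      obtain rfl : l = [] := List.length_eq_zero_iff.mp (by lia)
      obtain rfl : R = [] := List.length_eq_zero_iff.mp (by lia)
      simpa using HasSmallForestPartition.empty
    | succ b ih =>
      match l, R, hlen, hR with
      | x :: y :: l, r :: R, hlen, hR =>
        have hxy := (List.isChain_cons_cons.mp hl).1
        have hnd3 : [x, y, r].Nodup := by grind
        have hsmall : G.IsSmallLinearForest {x, y, r} :=
          ⟨.inl (by simpa using List.toFinset_card_of_nodup hnd3),
            isLinearForest_induce_of_compl_edge hxy⟩
        have hnd' : (l ++ R).Nodup :=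
          hnd.sublist (((List.sublist_cons_self y l).cons x).append (List.sublist_cons_self r R))
        have hrest := ih R (by simpa using hR) l hnd' hl.tail.tail (by simp at hlen; lia)
        convert hsmall.hasSmallForestPartition.union ?_ hrest using 1
        · ext v
          simp
        · lia
        · rw [Finset.disjoint_left]
          simp at hnd ⊢
          grind
  | succ a ih =>
    match l, hlen with
    | x :: y :: z :: w :: l, hlen =>
      have hnd4 : [x, y, z, w].Nodup := by grind
      obtain ⟨hxy, hyz, hzw, -⟩ : Gᶜ.Adj x y ∧ Gᶜ.Adj y z ∧ Gᶜ.Adj z w ∧ _ := by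
        simpa only [List.isChain_cons_cons] using hl
      have hsmall : G.IsSmallLinearForest {x, y, z, w} :=
        ⟨.inr (by simpa using List.toFinset_card_of_nodup hnd4),
          isLinearForest_induce_of_compl_path hxy hyz hzw⟩
      have hrest := ih l (by grind) hl.tail.tail.tail.tail (by simp at hlen; lia)
      convert hsmall.hasSmallForestPartition.union ?_ hrest using 1
      · ext v
        simp
      · lia
      · rw [Finset.disjoint_left]
        simp at hnd ⊢
        grind
    | [], hlen | [_], hlen | [_, _], hlen | [_, _, _], hlen => simp at hlen; try lia

/-- Two disjoint paths of the complement that together contain enough disjoint pairs of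
consecutive vertices yield a partition of the whole vertex set. -/
theorem hasSmallForestPartition_univ_of_isChain_compl [DecidableEq V] [Fintype V] {a b : ℕ}
    (hb : 0 < b) (hcard : Fintype.card V = 4 * a + 3 * b) {l₁ l₂ : List V} (hnd : (l₁ ++ l₂).Nodup)
    (hl₁ : l₁.IsChain Gᶜ.Adj) (hl₂ : l₂.IsChain Gᶜ.Adj)
    (hlen : 2 * a + b ≤ l₁.length / 2 + l₂.length / 2) :
    G.HasSmallForestPartition Finset.univ (a + b) := by
  obtain ⟨p₁, p₂, hp, hp₁, hp₂⟩ :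
      ∃ p₁ p₂, p₁ + p₂ = 2 * a + b ∧ 2 * p₁ ≤ l₁.length ∧ 2 * p₂ ≤ l₂.length :=
    ⟨min (l₁.length / 2) (2 * a + b), 2 * a + b - min (l₁.length / 2) (2 * a + b), by lia,
      by lia, by lia⟩
  obtain ⟨a₁, b₁, a₂, b₂, rfl, rfl, h₁, h₂⟩ :
      ∃ a₁ b₁ a₂ b₂, a₁ + a₂ = a ∧ b₁ + b₂ = b ∧ 2 * a₁ + b₁ = p₁ ∧ 2 * a₂ + b₂ = p₂ :=
    ⟨min a (p₁ / 2), p₁ - 2 * min a (p₁ / 2), a - min a (p₁ / 2),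
      b - (p₁ - 2 * min a (p₁ / 2)), by lia, by lia, by lia, by lia⟩
  set m₁ := l₁.take (2 * p₁) with hm₁
  set m₂ := l₂.take (2 * p₂) with hm₂
  have hm₁len : m₁.length = 4 * a₁ + 2 * b₁ := by rw [hm₁, List.length_take]; lia
  have hm₂len : m₂.length = 4 * a₂ + 2 * b₂ := by rw [hm₂, List.length_take]; lia
  have hmnd : (m₁ ++ m₂).Nodup :=
    hnd.sublist ((List.take_sublist _ _).append (List.take_sublist _ _))
  set R := ((m₁ ++ m₂).toFinsetᶜ).toList with hR
  have hRlen : R.length = b₁ + b₂ := by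
    rw [hR, Finset.length_toList, Finset.card_compl, List.toFinset_card_of_nodup hmnd,
      List.length_append]
    lia
  have hRnd : R.Nodup := Finset.nodup_toList _
  have hRmem : ∀ v, v ∈ R ↔ v ∉ m₁ ∧ v ∉ m₂ := by simp [hR]
  have hsplit : ∀ v, v ∈ R ↔ v ∈ R.take b₁ ∨ v ∈ R.drop b₁ := fun v => by
    rw [← List.mem_append, List.take_append_drop]
  have hRdisj : ∀ v, v ∈ R.take b₁ → v ∉ R.drop b₁ := by
    intro v hv hv'
    exact List.disjoint_take_drop hRnd le_rfl hv hv'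
  have hpart₁ := hasSmallForestPartition_of_isChain_compl a₁ b₁ m₁ (R.take b₁)
    (by
      rw [List.nodup_append]
      exact ⟨by grind, hRnd.sublist (List.take_sublist _ _), by grind⟩)
    (hl₁.take _) hm₁len (by rw [List.length_take]; lia)
  have hpart₂ := hasSmallForestPartition_of_isChain_compl a₂ b₂ m₂ (R.drop b₁)
    (by
      rw [List.nodup_append]
      exact ⟨by grind, hRnd.sublist (List.drop_sublist _ _), by grind⟩)
    (hl₂.take _) hm₂len (by rw [List.length_drop]; lia)
  have hm : ∀ v ∈ m₁, v ∉ m₂ := fun v h h' => (List.nodup_append.mp hmnd).2.2 v h v h' rfl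
  convert hpart₁.union ?_ hpart₂ using 1
  · ext v
    have := hsplit v
    have := hRmem v
    simp only [Finset.mem_univ, List.toFinset_append, Finset.mem_union, List.mem_toFinset,
      true_iff]
    tauto
  · lia
  · rw [Finset.disjoint_left]
    intro v
    have := hsplit v
    have := hRmem v
    have := hRdisj v
    have := hm v
    simp only [List.toFinset_append, Finset.mem_union, List.mem_toFinset]
    tauto

/-! ### Long paths in graphs of large minimum degree -/

/-- A path all of whose vertices lie on a common cycle is extended by any edge leaving it. -/
theorem exists_isChain_perm_cons_of_closed {H : SimpleGraph V} {l : List V}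
    (hl : l.IsChain H.Adj) (hclosed : ∀ p ∈ l.getLast?, ∀ q ∈ l.head?, H.Adj p q) {x y : V}
    (hy : y ∈ l) (hxy : H.Adj x y) : ∃ l' : List V, l'.IsChain H.Adj ∧ l'.Perm (x :: l) := by
  obtain ⟨s, t, rfl⟩ := List.append_of_mem hy
  refine ⟨x :: (y :: t ++ s), ?_, List.Perm.cons x List.perm_append_comm⟩
  have hs := hl.left_of_append
  have ht := hl.right_of_append
  refine List.IsChain.cons_cons hxy (ht.append hs fun p hp q hq => hclosed p ?_ q ?_)
  · rw [List.getLast?_append, Option.mem_def.mp hp]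
    simp
  · rw [List.head?_append, Option.mem_def.mp hq]
    simp

/-- A path containing all neighbours of its two ends and having at most `2 * d` vertices, where
`d` is a lower bound on the degrees, can be rearranged into a cycle. -/
theorem exists_isChain_perm_closed [Fintype V] {H : SimpleGraph V} [DecidableRel H.Adj] {d : ℕ}
    (hd : ∀ v, d ≤ H.degree v) {l : List V} (hl : l.IsChain H.Adj) (hne : l ≠ [])
    (hhead : ∀ y, H.Adj (l.head hne) y → y ∈ l) (hlast : ∀ y, H.Adj (l.getLast hne) y → y ∈ l)
    (hlen : l.length ≤ 2 * d) :
    ∃ l' : List V, l'.IsChain H.Adj ∧ l'.Perm l ∧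
      ∀ p ∈ l'.getLast?, ∀ q ∈ l'.head?, H.Adj p q := by
  classical
  have hpos : 0 < l.length := List.length_pos_iff.mpr hne
  let I : Finset (Fin (l.length - 1)) := {i | H.Adj (l.head hne) (l[i.1 + 1]'(by lia))}
  let J : Finset (Fin (l.length - 1)) := {i | H.Adj (l.getLast hne) (l[i.1]'(by lia))}
  have hI : d ≤ I.card := by
    refine (hd (l.head hne)).trans ((Finset.card_le_card (t := I.image fun i =>
      l[i.1 + 1]'(by lia)) fun y hy => ?_).trans Finset.card_image_le)
    have hadj : H.Adj (l.head hne) y := by simpa using hy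
    obtain ⟨j, hj, rfl⟩ := List.mem_iff_getElem.mp (hhead y hadj)
    rcases j with _ | j
    · rw [List.head_eq_getElem] at hadj
      exact absurd hadj H.irrefl
    · exact Finset.mem_image.mpr ⟨⟨j, by lia⟩, by simpa [I] using hadj, rfl⟩
  have hJ : d ≤ J.card := by
    refine (hd (l.getLast hne)).trans ((Finset.card_le_card (t := J.image fun i =>
      l[i.1]'(by lia)) fun y hy => ?_).trans Finset.card_image_le)
    have hadj : H.Adj (l.getLast hne) y := by simpa using hy
    obtain ⟨j, hj, rfl⟩ := List.mem_iff_getElem.mp (hlast y hadj)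
    by_cases hjl : j = l.length - 1
    · subst hjl
      rw [List.getLast_eq_getElem] at hadj
      exact absurd hadj H.irrefl
    · exact Finset.mem_image.mpr ⟨⟨j, by lia⟩, by simpa [J] using hadj, rfl⟩
  obtain ⟨i, hi⟩ : (I ∩ J).Nonempty := by
    rw [← Finset.card_pos]
    have hunion := Finset.card_union_add_card_inter I J
    have hle := Finset.card_le_univ (I ∪ J)
    rw [Fintype.card_fin] at hle
    lia
  obtain ⟨hiI, hiJ⟩ := Finset.mem_inter.mp hi
  have hiI : H.Adj (l.head hne) (l[i.1 + 1]'(by lia)) := by simpa [I] using hiI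
  have hiJ : H.Adj (l.getLast hne) (l[i.1]'(by lia)) := by simpa [J] using hiJ
  refine ⟨l.take (i.1 + 1) ++ (l.drop (i.1 + 1)).reverse, ?_, ?_, ?_⟩
  · refine (hl.take _).append (List.isChain_reverse.mpr ((hl.drop _).imp fun _ _ h => h.symm)) ?_
    intro p hp q hq
    rw [List.head?_reverse, List.getLast?_drop, if_neg (by lia),
      List.getLast?_eq_getLast_of_ne_nil hne] at hq
    rw [List.getLast?_take, if_neg (by lia)] at hp
    have hp' : l[i.1]'(by lia) = p := by
      simpa [List.getElem?_eq_getElem (show i.1 < l.length by lia)] using hp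
    have hq' : l.getLast hne = q := by simpa using hq
    exact hp' ▸ hq' ▸ hiJ.symm
  · refine ((List.reverse_perm _).append_left _).trans ?_
    rw [List.take_append_drop]
  · intro p hp q hq
    have hp' : l[i.1 + 1]'(by lia) = p := by
      simpa [List.getLast?_append, List.getLast?_reverse, List.head?_drop,
        List.getElem?_eq_getElem (show i.1 + 1 < l.length by lia)] using hp
    have hq' : l.head hne = q := by
      simpa [List.head?_append, List.head?_take, List.head?_eq_some_head hne] using hq
    exact hp' ▸ hq' ▸ hiI.symm

/-- In a nonempty set `S` closed under adjacency, a graph with all degrees at least `d` has a path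
that has more than `2 * d` vertices or whose vertex set is closed under adjacency. -/
theorem exists_isChain_long_or_adj_closed [Fintype V] {H : SimpleGraph V} [DecidableRel H.Adj]
    {d : ℕ} (hd : ∀ v, d ≤ H.degree v) {S : Set V} (hS : S.Nonempty)
    (hadj : ∀ x ∈ S, ∀ y, H.Adj x y → y ∈ S) :
    ∃ l : List V, l ≠ [] ∧ l.Nodup ∧ l.IsChain H.Adj ∧ (∀ x ∈ l, x ∈ S) ∧
      (2 * d < l.length ∨ ∀ x ∈ l, ∀ y, H.Adj x y → y ∈ l) := by
  classical
  by_contra! hcon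
  have key : ∀ m : ℕ, ∃ l : List V, l ≠ [] ∧ l.Nodup ∧ l.IsChain H.Adj ∧ (∀ x ∈ l, x ∈ S) ∧
      m ≤ l.length := by
    intro m
    induction m with
    | zero =>
      obtain ⟨s, hs⟩ := hS
      exact ⟨[s], by simp, by simp, by simp, by simpa using hs, by simp⟩
    | succ m ih =>
      obtain ⟨l, hne, hnd, hl, hlS, hm⟩ := ih
      have extend : ∀ (l' : List V) (x y : V), l'.IsChain H.Adj → l'.Perm (x :: l) → y ∈ l →
          H.Adj y x → x ∉ l → ∃ l : List V, l ≠ [] ∧ l.Nodup ∧ l.IsChain H.Adj ∧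
            (∀ x ∈ l, x ∈ S) ∧ m + 1 ≤ l.length := by
        intro l' x y hl' hperm hy hyx hx
        refine ⟨l', ?_, hperm.nodup_iff.mpr (List.nodup_cons.mpr ⟨hx, hnd⟩), hl', ?_, ?_⟩
        · rintro rfl
          simpa using hperm.length_eq
        · intro z hz
          rcases List.mem_cons.mp (hperm.mem_iff.mp hz) with rfl | hz
          · exact hadj y (hlS y hy) z hyx
          · exact hlS z hz
        · rw [hperm.length_eq, List.length_cons]
          lia
      by_cases hhead : ∀ y, H.Adj (l.head hne) y → y ∈ l
      · by_cases hlast : ∀ y, H.Adj (l.getLast hne) y → y ∈ l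
        · obtain ⟨hlen, y, hy, x, hyx, hx⟩ := hcon l hne hnd hl hlS
          obtain ⟨c, hc, hperm, hclosed⟩ := exists_isChain_perm_closed hd hl hne hhead hlast hlen
          obtain ⟨l', hl', hperm'⟩ :=
            exists_isChain_perm_cons_of_closed hc hclosed (hperm.mem_iff.mpr hy) hyx.symm
          exact extend l' x y hl' (hperm'.trans (hperm.cons x)) hy hyx hx
        · push Not at hlast
          obtain ⟨x, hlx, hx⟩ := hlast
          refine extend (l ++ [x]) x _ (hl.append (by simp) fun p hp q hq => ?_)
            List.perm_append_comm (List.getLast_mem hne) hlx hx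
          rw [List.getLast?_eq_getLast_of_ne_nil hne] at hp
          simp only [List.head?_cons, Option.mem_def, Option.some.injEq] at hp hq
          exact hp ▸ hq ▸ hlx
      · push Not at hhead
        obtain ⟨x, hlx, hx⟩ := hhead
        refine extend (x :: l) x _ (hl.cons_of_ne_nil hne hlx.symm) (.refl _)
          (List.head_mem hne) hlx hx
  obtain ⟨l, -, hnd, -, -, hlen⟩ := key (Fintype.card V + 1)
  have := hnd.length_le_card
  lia

/-- A nonempty list of vertices closed under adjacency contains a closed neighbourhood. -/
theorem lt_length_of_adj_closed [Fintype V] {H : SimpleGraph V} [DecidableRel H.Adj] {d : ℕ}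
    (hd : ∀ v, d ≤ H.degree v) {l : List V} {v : V} (hv : v ∈ l)
    (hadj : ∀ y, H.Adj v y → y ∈ l) : d < l.length := by
  classical
  have hsub : insert v (H.neighborFinset v) ⊆ l.toFinset := by
    intro y hy
    rcases Finset.mem_insert.mp hy with rfl | hy
    · simpa using hv
    · simpa using hadj y (by simpa using hy)
  have hcard := (Finset.card_le_card hsub).trans l.toFinset_card_le
  rw [Finset.card_insert_of_notMem (by simp), card_neighborFinset_eq_degree] at hcard
  have := hd v
  lia

/-- If the complement of `G` has minimum degree at least `2 * a + b`, where `G` has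
`4 * a + 3 * b` vertices, then `G` splits into `a + b` linear forests on three or four vertices. -/
theorem hasSmallForestPartition_univ_of_le_degree_compl [Fintype V] [DecidableEq V]
    [DecidableRel G.Adj] {a b : ℕ} (hb : 0 < b) (hcard : Fintype.card V = 4 * a + 3 * b)
    (hdeg : ∀ v, 2 * a + b ≤ Gᶜ.degree v) : G.HasSmallForestPartition Finset.univ (a + b) := by
  have : Nonempty V := Fintype.card_pos_iff.mp (by lia)
  obtain ⟨l₁, hne₁, hnd₁, hl₁, -, hlong₁ | hadj₁⟩ :=
    exists_isChain_long_or_adj_closed hdeg (S := Set.univ) Set.univ_nonempty (by simp)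
  · exact hasSmallForestPartition_univ_of_isChain_compl hb hcard (l₁ := l₁) (l₂ := [])
      (by simpa using hnd₁) hl₁ (by simp) (by simp; lia)
  by_cases hall : ∀ v, v ∈ l₁
  · have hlen : l₁.length = Fintype.card V := by
      rw [← List.toFinset_card_of_nodup hnd₁, ← Finset.card_univ]
      congr 1
      ext v
      simpa using hall v
    exact hasSmallForestPartition_univ_of_isChain_compl hb hcard (l₁ := l₁) (l₂ := [])
      (by simpa using hnd₁) hl₁ (by simp) (by simp; lia)
  push Not at hall
  obtain ⟨l₂, hne₂, hnd₂, hl₂, hmem₂, hlong₂ | hadj₂⟩ :=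
    exists_isChain_long_or_adj_closed hdeg (S := {v | v ∉ l₁}) hall
      fun x hx y hxy hy => hx (hadj₁ y hy x hxy.symm)
  · exact hasSmallForestPartition_univ_of_isChain_compl hb hcard (l₁ := l₂) (l₂ := [])
      (by simpa using hnd₂) hl₂ (by simp) (by simp; lia)
  have hnd : (l₁ ++ l₂).Nodup :=
    List.nodup_append.mpr ⟨hnd₁, hnd₂, fun x hx y hy hxy => hmem₂ y hy (hxy ▸ hx)⟩
  have hlen₁ := lt_length_of_adj_closed hdeg (List.head_mem hne₁) (hadj₁ _ (List.head_mem hne₁))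
  have hlen₂ := lt_length_of_adj_closed hdeg (List.head_mem hne₂) (hadj₂ _ (List.head_mem hne₂))
  have hcompl : (l₁ ++ l₂).toFinsetᶜ.card + (l₁.length + l₂.length) = Fintype.card V := by
    rw [← List.length_append, ← List.toFinset_card_of_nodup hnd, add_comm,
      Finset.card_add_card_compl]
  have hcover : (l₁ ++ l₂).toFinsetᶜ.card = 0 := by
    rw [Finset.card_eq_zero, Finset.eq_empty_iff_forall_notMem]
    intro v hv
    have hv' : v ∉ l₁ ∧ v ∉ l₂ := by simpa using hv
    have hlen₃ := lt_length_of_adj_closed hdeg (l := ((l₁ ++ l₂).toFinsetᶜ).toList) (v := v)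
      (by simpa using hv) fun y hvy => by
        simpa using ⟨fun hy => hv'.1 (hadj₁ y hy v hvy.symm),
          fun hy => hv'.2 (hadj₂ y hy v hvy.symm)⟩
    rw [Finset.length_toList] at hlen₃
    lia
  exact hasSmallForestPartition_univ_of_isChain_compl hb hcard hnd hl₁ hl₂ (by lia)

end SimpleGraph

theorem partition_into_parts_of_size_three_or_four
    {V : Type*} [Fintype V] (G : SimpleGraph V) [DecidableRel G.Adj]
    (hΔ : ((Fintype.card V : ℚ) - 1) / 2 ≤ (G.maxDegree : ℚ))
    (k : ℕ)
    (hk1 : (⌈((G.maxDegree : ℚ) + 1) / 2⌉ : ℤ) ≤ (k : ℤ))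
    (hk2 : (k : ℚ) < (Fintype.card V : ℚ) / 3) :
    ∃ P : Fin k → Finset V,
      (∀ v : V, ∃! i : Fin k, v ∈ P i) ∧
      (∀ i : Fin k, (P i).card = 3 ∨ (P i).card = 4) ∧
      (∀ i : Fin k, (G.induce (↑(P i) : Set V)).IsLinearForest) := by
  classical
  have hΔ' : Fintype.card V ≤ 2 * G.maxDegree + 1 := by
    have : (Fintype.card V : ℚ) ≤ 2 * G.maxDegree + 1 := by linarith
    exact_mod_cast this
  have hk1' : G.maxDegree + 1 ≤ 2 * k := by
    have h := Int.ceil_le.mp hk1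
    push_cast at h
    have : (G.maxDegree : ℚ) + 1 ≤ 2 * k := by linarith
    exact_mod_cast this
  have hk2' : 3 * k < Fintype.card V := by
    have : 3 * (k : ℚ) < Fintype.card V := by linarith
    exact_mod_cast this
  obtain ⟨f, hfk, hf⟩ := SimpleGraph.hasSmallForestPartition_univ_of_le_degree_compl (G := G)
    (a := Fintype.card V - 3 * k) (b := 4 * k - Fintype.card V) (by lia) (by lia) fun v => by
      rw [SimpleGraph.degree_compl]
      have := G.degree_le_maxDegree v
      lia
  rw [show Fintype.card V - 3 * k + (4 * k - Fintype.card V) = k by lia] at hfk hf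
  refine ⟨fun i => Finset.univ.filter fun v => f v = i, fun v => ?_, fun i => (hf i i.2).1,
    fun i => (hf i i.2).2⟩
  exact ⟨⟨f v, hfk v (Finset.mem_univ v)⟩, by simp, fun j hj =>
    Fin.ext (by simpa using (Finset.mem_filter.mp hj).2.symm)⟩
end
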